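/- arXiv:2512.06137 — 9 statements merged into one kernel-verified Lean document; each statement's English description precedes it below -/
import Mathlib

section
/- For every a > 0, the limit as b → a (b > 0, b ≠ a) of a/(a² − b²) − a^{2/N−1}/(N(a^{2/N} − b^{2/N})) exists and equals (1/(2a))(1 − 1/N). Consequently the function r_N, extended by r_N(a,a) = (1/(2a))(1 − 1/N), is continuous at every diagonal point (a,a) with a > 0. -/
open Real Filter

/-- `r_N(a,b) = a/(a² − b²) − a^{2/N−1}/(N(a^{2/N} − b^{2/N}))` off the diagonal,
with diagonal value `(1/(2a))(1 − 1/N)`. -/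
noncomputable def rN (N : ℕ) (a b : ℝ) : ℝ :=
  if a = b then (1/(2*a)) * (1 - 1/(N:ℝ))
  else a/(a^2 - b^2) - a^((2:ℝ)/N - 1)/((N:ℝ) * (a^((2:ℝ)/N) - b^((2:ℝ)/N)))

/-- The function `1/(1 - eᵛ) + 1/v`, extended to `v = 0` by its limit `1/2`. -/
noncomputable def expPoleRemainder (v : ℝ) : ℝ :=
  if v = 0 then 1/2 else 1/(1 - exp v) + 1/v

theorem tendsto_exp_sub_one_div :
    Tendsto (fun v : ℝ => (exp v - 1)/v) (nhdsWithin 0 {0}ᶜ) (nhds 1) := by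
  have h := (hasDerivAt_iff_tendsto_slope.mp (Real.hasDerivAt_exp 0))
  rw [exp_zero] at h
  refine h.congr fun v => ?_
  simp [slope_def_field]

theorem tendsto_exp_sub_one_sub_id_div_sq :
    Tendsto (fun v : ℝ => (exp v - 1 - v)/v^2) (nhdsWithin 0 {0}ᶜ) (nhds (1/2)) := by
  rw [tendsto_iff_norm_sub_tendsto_zero]
  have hlim : Tendsto (fun v : ℝ => |v|) (nhdsWithin 0 {0}ᶜ) (nhds 0) := by
    have h : Tendsto (fun v : ℝ => |v|) (nhds 0) (nhds |0|) := continuous_abs.tendsto 0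
    rw [abs_zero] at h
    exact h.mono_left nhdsWithin_le_nhds
  have hsmall : ∀ᶠ v : ℝ in nhdsWithin 0 {0}ᶜ, |v| < 1 :=
    hlim.eventually (gt_mem_nhds one_pos)
  refine squeeze_zero' (Eventually.of_forall fun _ => norm_nonneg _) ?_ hlim
  filter_upwards [hsmall, self_mem_nhdsWithin] with v hv hv0
  have hv0 : v ≠ 0 := hv0
  have hb := Real.exp_bound hv.le (n := 3) (by norm_num)
  norm_num [Finset.sum_range_succ, Nat.factorial] at hb
  have hpos : 0 < |v| := abs_pos.mpr hv0
  have heq : (exp v - 1 - v)/v^2 - 1/2 = (exp v - (1 + v + v^2/2))/v^2 := by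
    field_simp
    ring
  rw [heq, Real.norm_eq_abs, abs_div, abs_pow, div_le_iff₀ (by positivity)]
  nlinarith [pow_pos hpos 3]

theorem continuousAt_expPoleRemainder_zero : ContinuousAt expPoleRemainder 0 := by
  rw [continuousAt_iff_punctured_nhds]
  have h := tendsto_exp_sub_one_sub_id_div_sq.div tendsto_exp_sub_one_div one_ne_zero
  have h0 : expPoleRemainder 0 = 1/2/1 := by simp [expPoleRemainder]
  rw [h0]
  refine h.congr' ?_
  filter_upwards [self_mem_nhdsWithin] with v hv
  have hv : v ≠ 0 := hv
  have he : exp v - 1 ≠ 0 := by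
    rw [sub_ne_zero]
    exact mt (Real.exp_eq_one_iff v).mp hv
  have he' : 1 - exp v ≠ 0 := by
    rw [← neg_sub]
    exact neg_ne_zero.mpr he
  simp only [expPoleRemainder, if_neg hv, Pi.div_apply]
  field_simp
  ring

theorem rN_eq_expPoleRemainder {N : ℕ} (hN : N ≠ 0) {a b : ℝ} (ha : 0 < a) (hb : 0 < b) :
    rN N a b = 1/a * (expPoleRemainder (2 * (log b - log a)) -
      1/(N:ℝ) * expPoleRemainder ((2:ℝ)/N * (log b - log a))) := by
  have hN0 : (N:ℝ) ≠ 0 := Nat.cast_ne_zero.mpr hN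
  by_cases hab : a = b
  · subst hab
    simp only [rN, expPoleRemainder, sub_self, mul_zero, if_true]
    field_simp
  have hu : log b - log a ≠ 0 := fun h =>
    hab (Real.log_injOn_pos ha hb (sub_eq_zero.mp h).symm)
  have hs : (2:ℝ)/N ≠ 0 := div_ne_zero two_ne_zero hN0
  have hexp (s : ℝ) : exp (s * (log b - log a)) = b^s/a^s := by
    rw [Real.rpow_def_of_pos ha, Real.rpow_def_of_pos hb, ← Real.exp_sub]
    ring_nf
  have hne {s : ℝ} (h : s ≠ 0) : a^s - b^s ≠ 0 := fun h' =>
    hab (Real.rpow_left_injOn h ha.le hb.le (sub_eq_zero.mp h'))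
  have hone {s : ℝ} : 1/(1 - b^s/a^s) = a^s/(a^s - b^s) := by
    have := (Real.rpow_pos_of_pos ha s).ne'
    rw [one_sub_div this, one_div_div]
  have h2 : a^2 - b^2 ≠ 0 := by
    simpa using hne two_ne_zero
  have hsne := hne hs
  simp only [rN, if_neg hab, expPoleRemainder, if_neg (mul_ne_zero two_ne_zero hu),
    if_neg (mul_ne_zero hs hu), hexp, hone, Real.rpow_sub_one ha.ne', Real.rpow_two]
  generalize a^((2:ℝ)/N) = A at *
  generalize b^((2:ℝ)/N) = B at *
  generalize log b - log a = u at *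
  field_simp
  ring

theorem continuousWithinAt_rN_diag {N : ℕ} (hN : N ≠ 0) {a : ℝ} (ha : 0 < a) :
    ContinuousWithinAt (fun p : ℝ × ℝ => rN N p.1 p.2)
      {p : ℝ × ℝ | 0 < p.1 ∧ 0 < p.2} (a, a) := by
  have hlog : ContinuousAt (fun p : ℝ × ℝ => log p.2 - log p.1) (a, a) :=
    (continuousAt_snd.log ha.ne').sub (continuousAt_fst.log ha.ne')
  have hrem (s : ℝ) : ContinuousAt
      (fun p : ℝ × ℝ => expPoleRemainder (s * (log p.2 - log p.1))) (a, a) := by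
    refine ContinuousAt.comp_of_eq continuousAt_expPoleRemainder_zero
      (continuousAt_const.mul hlog) ?_
    simp
  have hcont : ContinuousAt (fun p : ℝ × ℝ =>
      1/p.1 * (expPoleRemainder (2 * (log p.2 - log p.1)) -
        1/(N:ℝ) * expPoleRemainder ((2:ℝ)/N * (log p.2 - log p.1)))) (a, a) :=
    (continuousAt_const.div continuousAt_fst ha.ne').mul
      ((hrem 2).sub (continuousAt_const.mul (hrem _)))
  exact hcont.continuousWithinAt.congr
    (fun p hp => rN_eq_expPoleRemainder hN hp.1 hp.2) (rN_eq_expPoleRemainder hN ha ha)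

/-- As `b → a` (with `b > 0`, `b ≠ a`), the off-diagonal expression defining `r_N`
tends to `(1/(2a))(1 − 1/N)`; consequently `r_N` (extended by this diagonal value)
is continuous at every diagonal point `(a,a)` with `a > 0`. -/
theorem stmt2 (N : ℕ) (hN : 2 ≤ N) (a : ℝ) (ha : 0 < a) :
    Tendsto (fun b : ℝ =>
        a/(a^2 - b^2) - a^((2:ℝ)/N - 1)/((N:ℝ) * (a^((2:ℝ)/N) - b^((2:ℝ)/N))))
      (nhdsWithin a {b : ℝ | 0 < b ∧ b ≠ a})
      (nhds ((1/(2*a)) * (1 - 1/(N:ℝ)))) ∧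
    ContinuousWithinAt (fun p : ℝ × ℝ => rN N p.1 p.2)
      {p : ℝ × ℝ | 0 < p.1 ∧ 0 < p.2} (a, a) := by
  have hcont := continuousWithinAt_rN_diag (N := N) (by omega) ha
  refine ⟨?_, hcont⟩
  have hpair : Tendsto (fun b : ℝ => (a, b)) (nhdsWithin a {b : ℝ | 0 < b ∧ b ≠ a})
      (nhdsWithin (a, a) {p : ℝ × ℝ | 0 < p.1 ∧ 0 < p.2}) :=
    (Continuous.continuousWithinAt (by fun_prop)).tendsto_nhdsWithin
      fun b hb => ⟨ha, hb.1⟩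
  have hdiag : rN N a a = (1/(2*a)) * (1 - 1/(N:ℝ)) := if_pos rfl
  rw [← hdiag]
  refine (hcont.tendsto.comp hpair).congr' ?_
  filter_upwards [self_mem_nhdsWithin] with b hb
  exact if_neg hb.2.symm
end

section
/- For every σ ∈ (0,∞)^d with pairwise distinct entries, the second partial derivatives of the DLN entropy S_N satisfy: ∂²S_N/∂σ_i∂σ_j(σ) = p_N(σ_i, σ_j) for all i ≠ j, and ∂²S_N/∂σ_i²(σ) = Σ_{k≠i} q_N(σ_i, σ_k) for all i. -/
open Real Finset

/-- `Φ_N(a,b) = Σ_{m=0}^{N-1} a^{2(N-1-m)} b^{2m}`. -/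
noncomputable def Phi (N : ℕ) (a b : ℝ) : ℝ :=
  ∑ m ∈ Finset.range N, a ^ (2 * (N - 1 - m)) * b ^ (2 * m)

/-- The DLN entropy `S_N(σ) = c + (1/2) Σ_{j<k} log Φ_N(σ_j^{1/N}, σ_k^{1/N})`. -/
noncomputable def Sent (N d : ℕ) (c : ℝ) (σ : Fin d → ℝ) : ℝ :=
  c + (1/2) * ∑ p ∈ Finset.univ.filter (fun p : Fin d × Fin d => p.1 < p.2),
    Real.log (Phi N (σ p.1 ^ ((1:ℝ)/N)) (σ p.2 ^ ((1:ℝ)/N)))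

/-- The partial derivative of `f` with respect to the `i`-th coordinate. -/
noncomputable def pd (d : ℕ) (i : Fin d) (f : (Fin d → ℝ) → ℝ) (σ : Fin d → ℝ) : ℝ :=
  deriv (fun t => f (Function.update σ i t)) (σ i)

/-- `p_N(a,b) = 2ab/(a² − b²)² − 2 a^{2/N−1} b^{2/N−1}/(N(a^{2/N} − b^{2/N}))²`. -/
noncomputable def pN (N : ℕ) (a b : ℝ) : ℝ :=
  2*a*b/(a^2 - b^2)^2
    - 2 * a^((2:ℝ)/N - 1) * b^((2:ℝ)/N - 1) / ((N:ℝ) * (a^((2:ℝ)/N) - b^((2:ℝ)/N)))^2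

/-- `q_N(a,b) = −(a² + b²)/(a² − b²)² + a^{2/N−2}(N(a^{2/N} − b^{2/N}) + 2b^{2/N})/(N(a^{2/N} − b^{2/N}))²`. -/
noncomputable def qN (N : ℕ) (a b : ℝ) : ℝ :=
  -(a^2 + b^2)/(a^2 - b^2)^2
    + a^((2:ℝ)/N - 2) * ((N:ℝ) * (a^((2:ℝ)/N) - b^((2:ℝ)/N)) + 2 * b^((2:ℝ)/N))
      / ((N:ℝ) * (a^((2:ℝ)/N) - b^((2:ℝ)/N)))^2

theorem Phi_eq_geom_sum (N : ℕ) (a b : ℝ) :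
    Phi N a b = ∑ m ∈ Finset.range N, (b ^ 2) ^ m * (a ^ 2) ^ (N - 1 - m) := by
  unfold Phi
  refine Finset.sum_congr rfl fun m _ => ?_
  rw [← pow_mul, ← pow_mul, mul_comm]

theorem Phi_comm (N : ℕ) (a b : ℝ) : Phi N a b = Phi N b a := by
  rw [Phi_eq_geom_sum, Phi_eq_geom_sum, geom_sum₂_comm]

theorem rpow_one_div_sq {a : ℝ} (ha : 0 < a) (N : ℕ) :
    (a ^ ((1:ℝ)/N)) ^ 2 = a ^ ((2:ℝ)/N) := by
  rw [← Real.rpow_natCast, ← Real.rpow_mul ha.le]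
  congr 1
  push_cast
  ring

theorem rpow_two_div_pow {a : ℝ} (ha : 0 < a) {N : ℕ} (hN : 2 ≤ N) :
    (a ^ ((2:ℝ)/N)) ^ N = a ^ 2 := by
  have hN' : (N:ℝ) ≠ 0 := by positivity
  rw [← Real.rpow_natCast, ← Real.rpow_mul ha.le, div_mul_cancel₀ _ hN']
  exact_mod_cast Real.rpow_natCast a 2

theorem sq_sub_sq_ne_zero {a b : ℝ} (ha : 0 < a) (hb : 0 < b) (hab : a ≠ b) :
    a ^ 2 - b ^ 2 ≠ 0 := by
  rw [sq_sub_sq]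
  exact mul_ne_zero (by positivity) (sub_ne_zero.2 hab)

theorem Phi_mul_rpow_sub {a b : ℝ} (ha : 0 < a) (hb : 0 < b) {N : ℕ} (hN : 2 ≤ N) :
    Phi N (a ^ ((1:ℝ)/N)) (b ^ ((1:ℝ)/N)) * (a ^ ((2:ℝ)/N) - b ^ ((2:ℝ)/N)) = a ^ 2 - b ^ 2 := by
  rw [Phi_comm, Phi_eq_geom_sum, rpow_one_div_sq ha, rpow_one_div_sq hb, geom_sum₂_mul,
    rpow_two_div_pow ha hN, rpow_two_div_pow hb hN]

theorem rpow_two_div_sub_ne_zero {a b : ℝ} (ha : 0 < a) (hb : 0 < b) (hab : a ≠ b) {N : ℕ}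
    (hN : 2 ≤ N) : a ^ ((2:ℝ)/N) - b ^ ((2:ℝ)/N) ≠ 0 := fun h =>
  sq_sub_sq_ne_zero ha hb hab (by rw [← Phi_mul_rpow_sub ha hb hN, h, mul_zero])

theorem log_Phi_eq {a b : ℝ} (ha : 0 < a) (hb : 0 < b) (hab : a ≠ b) {N : ℕ} (hN : 2 ≤ N) :
    Real.log (Phi N (a ^ ((1:ℝ)/N)) (b ^ ((1:ℝ)/N))) =
      Real.log (a ^ 2 - b ^ 2) - Real.log (a ^ ((2:ℝ)/N) - b ^ ((2:ℝ)/N)) := by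
  have h := rpow_two_div_sub_ne_zero ha hb hab hN
  rw [← Real.log_div (sq_sub_sq_ne_zero ha hb hab) h, ← Phi_mul_rpow_sub ha hb hN,
    mul_div_cancel_right₀ _ h]

/-- Half of the derivative of `log Φ_N(a^{1/N}, b^{1/N})` in `a`. -/
noncomputable def pairGrad (N : ℕ) (a b : ℝ) : ℝ :=
  a / (a ^ 2 - b ^ 2) - a ^ ((2:ℝ)/N - 1) / ((N:ℝ) * (a ^ ((2:ℝ)/N) - b ^ ((2:ℝ)/N)))

theorem hasDerivAt_log_Phi {a b : ℝ} (ha : 0 < a) (hb : 0 < b) (hab : a ≠ b) {N : ℕ}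
    (hN : 2 ≤ N) :
    HasDerivAt (fun t => Real.log (Phi N (t ^ ((1:ℝ)/N)) (b ^ ((1:ℝ)/N))))
      (2 * pairGrad N a b) a := by
  have h1 := sq_sub_sq_ne_zero ha hb hab
  have h2 := rpow_two_div_sub_ne_zero ha hb hab hN
  have hN' : (N:ℝ) ≠ 0 := by positivity
  have hL := (((hasDerivAt_pow 2 a).sub_const (b ^ 2)).log h1).sub
    (((Real.hasDerivAt_rpow_const (p := (2:ℝ)/N) (Or.inl ha.ne')).sub_const
      (b ^ ((2:ℝ)/N))).log h2)
  refine (hL.congr_of_eventuallyEq ?_).congr_deriv ?_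
  · filter_upwards [lt_mem_nhds ha, isOpen_ne.mem_nhds hab] with t ht htb
    exact log_Phi_eq ht hb htb hN
  · unfold pairGrad
    field_simp
    norm_num
    ring

theorem hasDerivAt_pairGrad_left {a b : ℝ} (ha : 0 < a) (hb : 0 < b) (hab : a ≠ b) {N : ℕ}
    (hN : 2 ≤ N) : HasDerivAt (fun t => pairGrad N t b) (qN N a b) a := by
  have h1 := sq_sub_sq_ne_zero ha hb hab
  have h2 := rpow_two_div_sub_ne_zero ha hb hab hN
  have hN' : (N:ℝ) ≠ 0 := by positivity
  have hL := ((hasDerivAt_id a).div ((hasDerivAt_pow 2 a).sub_const (b ^ 2)) h1).sub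
    ((Real.hasDerivAt_rpow_const (p := (2:ℝ)/N - 1) (Or.inl ha.ne')).div
      (((Real.hasDerivAt_rpow_const (p := (2:ℝ)/N) (Or.inl ha.ne')).sub_const
        (b ^ ((2:ℝ)/N))).const_mul (N:ℝ)) (mul_ne_zero hN' h2))
  refine hL.congr_deriv ?_
  have e1 : a ^ ((2:ℝ)/N - 1) = a * a ^ ((2:ℝ)/N - 2) := by
    rw [show (2:ℝ)/N - 1 = 1 + ((2:ℝ)/N - 2) by ring, Real.rpow_add ha, Real.rpow_one]
  have e2 : a ^ ((2:ℝ)/N) = a ^ 2 * a ^ ((2:ℝ)/N - 2) := by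
    rw [Real.rpow_sub ha, Real.rpow_two]
    field_simp
  have e3 : (2:ℝ)/N - 1 - 1 = (2:ℝ)/N - 2 := by ring
  unfold qN
  rw [e3, e1]
  rw [e2] at h2 ⊢
  generalize a ^ ((2:ℝ)/N - 2) = x at *
  generalize b ^ ((2:ℝ)/N) = y at *
  simp only [id]
  field_simp
  ring

theorem hasDerivAt_pairGrad_right {a b : ℝ} (ha : 0 < a) (hb : 0 < b) (hab : a ≠ b) {N : ℕ}
    (hN : 2 ≤ N) : HasDerivAt (fun t => pairGrad N a t) (pN N b a) b := by
  have h1 := sq_sub_sq_ne_zero ha hb hab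
  have h2 := rpow_two_div_sub_ne_zero ha hb hab hN
  have hN' : (N:ℝ) ≠ 0 := by positivity
  have hL := ((hasDerivAt_const b a).div ((hasDerivAt_pow 2 b).const_sub (a ^ 2)) h1).sub
    ((hasDerivAt_const b (a ^ ((2:ℝ)/N - 1))).div
      (((Real.hasDerivAt_rpow_const (p := (2:ℝ)/N) (Or.inl hb.ne')).const_sub
        (a ^ ((2:ℝ)/N))).const_mul (N:ℝ)) (mul_ne_zero hN' h2))
  refine hL.congr_deriv ?_
  unfold pN
  rw [sub_sq_comm (b ^ 2), mul_pow, mul_pow, sub_sq_comm (b ^ ((2:ℝ)/N))]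
  field_simp
  ring

theorem sum_lt_pairs_eq_sum_erase {d : ℕ} (j : Fin d) (G : Fin d → ℝ) :
    ∑ p ∈ Finset.univ.filter (fun p : Fin d × Fin d => p.1 < p.2),
      (if p.1 = j then G p.2 else if p.2 = j then G p.1 else 0) =
    ∑ k ∈ Finset.univ.erase j, G k := by
  have h : ∀ a b : Fin d,
      (if a < b then (if a = j then G b else if b = j then G a else 0) else 0) =
      (if a = j then (if j < b then G b else 0) else 0) +
        (if b = j then (if a < j then G a else 0) else 0) := by
    intro a b
    by_cases ha : a = j <;> by_cases hb : b = j <;> simp [ha, hb]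
  rw [Finset.sum_filter, Fintype.sum_prod_type]
  simp only [h, Finset.sum_add_distrib]
  rw [Finset.sum_comm]
  simp only [Finset.sum_ite_eq', Finset.mem_univ, if_true]
  rw [← Finset.sum_add_distrib, ← Finset.sum_erase (a := j) Finset.univ (by simp)]
  refine Finset.sum_congr rfl fun k hk => ?_
  rcases lt_or_gt_of_ne (Finset.ne_of_mem_erase hk) with h | h <;> simp [h, h.not_gt]

theorem pd_Sent {N d : ℕ} (hN : 2 ≤ N) (c : ℝ) {τ : Fin d → ℝ} (hpos : ∀ i, 0 < τ i)
    (hinj : Function.Injective τ) (j : Fin d) :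
    pd d j (Sent N d c) τ = ∑ k ∈ Finset.univ.erase j, pairGrad N (τ j) (τ k) := by
  refine HasDerivAt.deriv ?_
  have key : ∀ p ∈ Finset.univ.filter (fun p : Fin d × Fin d => p.1 < p.2),
      HasDerivAt (fun t => Real.log (Phi N (Function.update τ j t p.1 ^ ((1:ℝ)/N))
        (Function.update τ j t p.2 ^ ((1:ℝ)/N))))
        (if p.1 = j then 2 * pairGrad N (τ j) (τ p.2)
          else if p.2 = j then 2 * pairGrad N (τ j) (τ p.1) else 0) (τ j) := by
    rintro ⟨a, b⟩ hp
    have hab : a ≠ b := (Finset.mem_filter.1 hp).2.ne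
    by_cases ha : a = j
    · subst ha
      simpa [Function.update_of_ne hab.symm] using
        hasDerivAt_log_Phi (hpos a) (hpos b) (hinj.ne hab) hN
    · by_cases hb : b = j
      · subst hb
        simp only [Function.update_self, Function.update_of_ne hab, if_neg hab, if_true]
        exact (hasDerivAt_log_Phi (hpos b) (hpos a) (hinj.ne hab.symm) hN).congr_of_eventuallyEq
          (.of_forall fun t => congrArg Real.log (Phi_comm N _ _))
      · simpa [ha, hb, Function.update_of_ne] using hasDerivAt_const _ _
  have hsum := ((HasDerivAt.fun_sum key).const_mul (1/2)).const_add c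
  refine hsum.congr_deriv ?_
  rw [sum_lt_pairs_eq_sum_erase j fun k => 2 * pairGrad N (τ j) (τ k), ← Finset.mul_sum]
  ring

theorem eventually_update_pos_injective {d : ℕ} {σ : Fin d → ℝ} (hpos : ∀ i, 0 < σ i)
    (hinj : Function.Injective σ) (i : Fin d) :
    ∀ᶠ t in nhds (σ i), (∀ k, 0 < Function.update σ i t k) ∧
      Function.Injective (Function.update σ i t) := by
  have hne : ∀ᶠ t in nhds (σ i), ∀ k, k ≠ i → t ≠ σ k :=
    Filter.eventually_all.2 fun k => by
      by_cases hk : k = i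
      · simp [hk]
      · filter_upwards [isOpen_ne.mem_nhds (hinj.ne (Ne.symm hk))] with t ht _ using ht
  filter_upwards [hne, lt_mem_nhds (hpos i)] with t ht h0
  refine ⟨fun k => ?_, fun k l hkl => ?_⟩
  · by_cases hk : k = i
    · simpa [hk] using h0
    · simpa [hk] using hpos k
  · by_cases hk : k = i <;> by_cases hl : l = i
    · rw [hk, hl]
    · subst hk
      rw [Function.update_self, Function.update_of_ne hl] at hkl
      exact absurd hkl (ht l hl)
    · subst hl
      rw [Function.update_self, Function.update_of_ne hk] at hkl
      exact absurd hkl.symm (ht k hk)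
    · rw [Function.update_of_ne hk, Function.update_of_ne hl] at hkl
      exact hinj hkl

/-- Second partial derivatives of the DLN entropy at a point with pairwise distinct
positive entries: `∂²S_N/∂σ_i∂σ_j = p_N(σ_i,σ_j)` for `i ≠ j` and
`∂²S_N/∂σ_i² = Σ_{k≠i} q_N(σ_i,σ_k)`. -/
theorem stmt3 (N d : ℕ) (hN : 2 ≤ N) (hd : 2 ≤ d) (c : ℝ)
    (σ : Fin d → ℝ) (hpos : ∀ i, 0 < σ i) (hdist : ∀ i j, i ≠ j → σ i ≠ σ j) :
    (∀ i j : Fin d, i ≠ j →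
      HasDerivAt (fun t => pd d j (Sent N d c) (Function.update σ i t))
        (pN N (σ i) (σ j)) (σ i)) ∧
    (∀ i : Fin d,
      HasDerivAt (fun t => pd d i (Sent N d c) (Function.update σ i t))
        (∑ k ∈ Finset.univ.erase i, qN N (σ i) (σ k)) (σ i)) := by
  have hinj : Function.Injective σ := fun k l hkl => by
    by_contra h
    exact hdist k l h hkl
  have hev : ∀ i j : Fin d, (fun t => pd d j (Sent N d c) (Function.update σ i t)) =ᶠ[nhds (σ i)]
      fun t => ∑ k ∈ Finset.univ.erase j,
        pairGrad N (Function.update σ i t j) (Function.update σ i t k) := fun i j => by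
    filter_upwards [eventually_update_pos_injective hpos hinj i] with t ht
    exact pd_Sent hN c ht.1 ht.2 j
  refine ⟨fun i j hij => ?_, fun i => ?_⟩
  · refine HasDerivAt.congr_of_eventuallyEq ?_ (hev i j)
    have key : ∀ k ∈ Finset.univ.erase j, HasDerivAt
        (fun t => pairGrad N (Function.update σ i t j) (Function.update σ i t k))
        (if k = i then pN N (σ i) (σ j) else 0) (σ i) := fun k _ => by
      by_cases hk : k = i
      · subst hk
        simpa [Function.update_of_ne hij.symm] using
          hasDerivAt_pairGrad_right (hpos j) (hpos k) (hinj.ne hij.symm) hN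
      · simpa [hk, Function.update_of_ne hij.symm] using hasDerivAt_const _ _
    refine (HasDerivAt.fun_sum key).congr_deriv ?_
    simp [hij]
  · refine HasDerivAt.congr_of_eventuallyEq ?_ (hev i i)
    refine HasDerivAt.fun_sum fun k hk => ?_
    have hk' := Finset.ne_of_mem_erase hk
    simpa [Function.update_of_ne hk'] using
      hasDerivAt_pairGrad_left (hpos i) (hpos k) (hinj.ne hk'.symm) hN
end

section
/- For every integer N ≥ 2 and all a, b > 0 with a ≠ b, one has p_N(a,b) < 0 and q_N(a,b) < 0. -/
open Real

open Finset in
/-- Pairing the terms `x ^ i` and `x ^ (m - i)` of a geometric sum. -/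
lemma two_mul_geom_sum_eq (x : ℝ) (m : ℕ) :
    2 * ∑ i ∈ range (m + 1), x ^ i = ∑ i ∈ range (m + 1), (x ^ i + x ^ (m - i)) := by
  have h := sum_range_reflect (fun i => x ^ i) (m + 1)
  simp only [Nat.add_sub_cancel] at h
  rw [sum_add_distrib, h, two_mul]

open Finset in
lemma two_mul_geom_sum_le {x : ℝ} (hx : 0 < x) (m : ℕ) :
    2 * ∑ i ∈ range (m + 1), x ^ i ≤ (m + 1) * (1 + x ^ m) := by
  rw [two_mul_geom_sum_eq]
  have key : ∀ i ∈ range (m + 1), x ^ i + x ^ (m - i) ≤ 1 + x ^ m := by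
    intro i hi
    have hsplit : x ^ m = x ^ i * x ^ (m - i) := by
      rw [← pow_add, Nat.add_sub_of_le (by simpa [Nat.lt_succ_iff] using hi)]
    rw [hsplit]
    rcases le_total x 1 with h | h
    · nlinarith [pow_le_one₀ hx.le h (n := i), pow_le_one₀ hx.le h (n := m - i)]
    · nlinarith [one_le_pow₀ h (n := i), one_le_pow₀ h (n := m - i)]
  simpa [mul_add] using sum_le_card_nsmul _ _ _ key

open Finset in
lemma le_two_mul_geom_sum {x : ℝ} (hx : 0 < x) (hx1 : x ≤ 1) (m : ℕ) :
    (m + 1) * (2 * x ^ m + x ^ m * (1 - x ^ m)) ≤ 2 * ∑ i ∈ range (m + 1), x ^ i := by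
  rw [two_mul_geom_sum_eq]
  have key : ∀ i ∈ range (m + 1),
      2 * x ^ m + x ^ m * (1 - x ^ m) ≤ x ^ i + x ^ (m - i) := by
    intro i hi
    have hsplit : x ^ m = x ^ i * x ^ (m - i) := by
      rw [← pow_add, Nat.add_sub_of_le (by simpa [Nat.lt_succ_iff] using hi)]
    rw [hsplit]
    have hp := pow_le_one₀ hx.le hx1 (n := i)
    have hq := pow_le_one₀ hx.le hx1 (n := m - i)
    have hp0 := pow_pos hx i
    have hq0 := pow_pos hx (m - i)
    generalize x ^ i = p at *
    generalize x ^ (m - i) = q at *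
    have h₁ : 0 ≤ p * (1 - q) * (1 - q) := by
      have := sub_nonneg.2 hq
      positivity
    have h₂ : 0 ≤ q * (1 - p) * (1 - p * q) := by
      have := sub_nonneg.2 hp
      have := sub_nonneg.2 (mul_le_one₀ hp hq0.le hq)
      positivity
    linear_combination h₁ + h₂
  simpa [mul_add] using card_nsmul_le_sum _ _ _ key

open Finset in
/-- The strict AM-GM inequality for the geometric sum with ratio `c ^ 2`. -/
lemma mul_pow_lt_geom_sum_sq {c : ℝ} (hc : 0 < c) (hc1 : c ≠ 1) {m : ℕ} (hm : m ≠ 0) :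
    (m + 1) * c ^ m < ∑ i ∈ range (m + 1), (c ^ 2) ^ i := by
  have hck : c ^ m ≠ 1 := fun h => hc1 ((pow_eq_one_iff_of_nonneg hc.le hm).1 h)
  have hlt : ∑ _i ∈ range (m + 1), 2 * c ^ m
      < ∑ i ∈ range (m + 1), ((c ^ 2) ^ i + (c ^ 2) ^ (m - i)) := by
    refine sum_lt_sum (fun i hi => ?_) ⟨0, by simp, ?_⟩
    · have hsplit : c ^ m = c ^ i * c ^ (m - i) := by
        rw [← pow_add, Nat.add_sub_of_le (by simpa [Nat.lt_succ_iff] using hi)]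
      rw [hsplit, pow_right_comm c 2, pow_right_comm c 2]
      linarith [two_mul_le_add_sq (c ^ i) (c ^ (m - i))]
    · rw [Nat.sub_zero, pow_zero, pow_right_comm]
      nlinarith [sq_pos_of_ne_zero (sub_ne_zero.2 hck)]
  rw [← two_mul_geom_sum_eq] at hlt
  simp only [sum_const, card_range, nsmul_eq_mul] at hlt
  push_cast at hlt
  linarith

open Finset in
lemma mul_geom_sum_sq_lt {x : ℝ} (hx : 0 < x) (hx1 : x ≠ 1) {m : ℕ} (hm : m ≠ 0) :
    ((m + 1) * (1 - x) + 2 * x) * (∑ i ∈ range (m + 1), x ^ i) ^ 2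
      < (m + 1) ^ 2 * (1 + x * x ^ m) := by
  have hgeom : (1 - x) * ∑ i ∈ range (m + 1), x ^ i = 1 - x * x ^ m := by
    rw [mul_neg_geom_sum, pow_succ']
  have hS : 0 < ∑ i ∈ range (m + 1), x ^ i := by positivity
  have hup := two_mul_geom_sum_le hx m
  have hlow := fun h => le_two_mul_geom_sum hx h m
  have hy : 0 < x ^ m := by positivity
  have hlt1 : x < 1 → x ^ m < 1 := fun h => pow_lt_one₀ hx.le h hm
  have hgt1 : 1 < x → 1 < x ^ m := fun h => one_lt_pow₀ h hm
  have hm0 : (1 : ℝ) ≤ m := by exact_mod_cast Nat.one_le_iff_ne_zero.2 hm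
  generalize ∑ i ∈ range (m + 1), x ^ i = S at *
  generalize x ^ m = y at *
  generalize (m : ℝ) = n at *
  have hneg : (1 - x) * (-2 * (1 + y) * (S - y) + (3 * n + 1) * y + (n - 1) * y ^ 2) < 0 := by
    rcases lt_or_gt_of_ne hx1 with h | h
    · refine mul_neg_of_pos_of_neg (by linarith) ?_
      have h₁ := hlow h.le
      have h₂ := mul_le_mul_of_nonneg_right h₁ (by positivity : 0 ≤ 1 + y)
      have h₃ : 0 < (n + 1) * y * (1 - y) * y := by
        have := sub_pos.2 (hlt1 h)
        positivity
      nlinarith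
    · refine mul_neg_of_neg_of_pos (by linarith) ?_
      have h₁ := mul_le_mul_of_nonneg_right hup (by positivity : 0 ≤ 1 + y)
      have h₂ : 0 < (n + 1) * (y - 1) := mul_pos (by linarith) (sub_pos.2 (hgt1 h))
      nlinarith
  set D := (n + 1) * (1 + y) + (n - 1) * (1 - x * y) with hD
  have hprod : (1 + y) * D < 2 * (n + 1) * (1 + x * y) := by
    linear_combination hneg + 2 * (1 + y) * hgeom
  have hle : ((n + 1) * (1 - x) + 2 * x) * S ^ 2 ≤ S * D := by
    have h₁ : ((n + 1) * (1 - x) + 2 * x) * S ^ 2 = S * (2 * S + (n - 1) * (1 - x * y)) := by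
      linear_combination S * (n - 1) * hgeom
    rw [h₁]
    exact mul_le_mul_of_nonneg_left (by linarith) hS.le
  refine hle.trans_lt ?_
  rcases le_or_gt 0 D with h | h
  · nlinarith [mul_le_mul_of_nonneg_right hup h]
  · exact (mul_neg_of_pos_of_neg hS h).trans (by positivity)

open Finset in
/-- `pN` and `qN` in the coordinates `a = A ^ N`, `b = (c * A) ^ N`, `N = m + 1`. -/
lemma pN_qN_eq {A c : ℝ} (hA : 0 < A) (hc : 0 < c) (hc1 : c ≠ 1) (m : ℕ) :
    pN (m + 1) (A ^ (m + 1)) ((c * A) ^ (m + 1))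
        = 2 * c / ((A ^ (m + 1)) ^ 2 * (1 - c ^ 2) ^ 2)
          * (c ^ m / (∑ i ∈ range (m + 1), (c ^ 2) ^ i) ^ 2 - 1 / (c ^ m * (m + 1) ^ 2)) ∧
    qN (m + 1) (A ^ (m + 1)) ((c * A) ^ (m + 1))
        = 1 / ((A ^ (m + 1)) ^ 2 * (1 - c ^ 2) ^ 2)
          * (((m + 1) * (1 - c ^ 2) + 2 * c ^ 2) / (m + 1) ^ 2
            - (1 + c ^ 2 * (c ^ 2) ^ m) / (∑ i ∈ range (m + 1), (c ^ 2) ^ i) ^ 2) := by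
  have hroot : ∀ {z : ℝ}, 0 < z → (z ^ (m + 1)) ^ ((2 : ℝ) / (m + 1 : ℕ)) = z ^ 2 := by
    intro z hz
    rw [← rpow_natCast, ← rpow_mul hz.le, mul_div_cancel₀ _ (by positivity)]
    exact_mod_cast rpow_natCast z 2
  have hcA := mul_pos hc hA
  have hgeom : (1 - c ^ 2) * ∑ i ∈ range (m + 1), (c ^ 2) ^ i = 1 - (c * c ^ m) ^ 2 := by
    rw [mul_neg_geom_sum]; ring
  have hS : 0 < ∑ i ∈ range (m + 1), (c ^ 2) ^ i := by positivity
  have hdiff : 1 - c ^ 2 ≠ 0 := by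
    intro h
    exact hc1 ((pow_eq_one_iff_of_nonneg hc.le two_ne_zero).1 (by linarith))
  have hG : 0 < A ^ (m + 1) := by positivity
  have hk : 0 < c ^ m := by positivity
  have hb : (c * A) ^ (m + 1) = c * c ^ m * A ^ (m + 1) := by ring
  unfold pN qN
  rw [rpow_sub (by positivity), rpow_sub (by positivity), rpow_sub (by positivity),
    hroot hA, hroot hcA, rpow_one, rpow_one, rpow_two, hb, pow_right_comm c 2 m]
  push_cast
  have hm : (0 : ℝ) < m + 1 := by positivity
  generalize ∑ i ∈ range (m + 1), (c ^ 2) ^ i = S at *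
  generalize A ^ (m + 1) = G at *
  generalize c ^ m = k at *
  generalize (m : ℝ) + 1 = n at *
  have h₁ : G ^ 2 - (c * k * G) ^ 2 = G ^ 2 * ((1 - c ^ 2) * S) := by rw [hgeom]; ring
  have h₂ : A ^ 2 - (c * A) ^ 2 = A ^ 2 * (1 - c ^ 2) := by ring
  rw [h₁, h₂]
  clear h₁ h₂ hgeom hroot hb
  generalize hd : 1 - c ^ 2 = d at *
  constructor
  · field_simp
  · field_simp
    ring

/-- For every integer `N ≥ 2` and all `a, b > 0` with `a ≠ b`,
`p_N(a,b) < 0` and `q_N(a,b) < 0`. -/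
theorem stmt4 (N : ℕ) (hN : 2 ≤ N) (a b : ℝ) (ha : 0 < a) (hb : 0 < b)
    (hab : a ≠ b) :
    pN N a b < 0 ∧ qN N a b < 0 := by
  obtain ⟨m, rfl⟩ : ∃ m, N = m + 1 := ⟨N - 1, by omega⟩
  have hm : m ≠ 0 := by omega
  obtain ⟨A, hA, rfl⟩ : ∃ A : ℝ, 0 < A ∧ A ^ (m + 1) = a :=
    ⟨_, rpow_pos_of_pos ha _, rpow_inv_natCast_pow ha.le m.succ_ne_zero⟩
  obtain ⟨B, hB, rfl⟩ : ∃ B : ℝ, 0 < B ∧ B ^ (m + 1) = b :=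
    ⟨_, rpow_pos_of_pos hb _, rpow_inv_natCast_pow hb.le m.succ_ne_zero⟩
  obtain ⟨c, rfl⟩ : ∃ c, B = c * A := ⟨B / A, by field_simp⟩
  have hc : 0 < c := pos_of_mul_pos_left hB hA.le
  have hc1 : c ≠ 1 := by
    rintro rfl
    simp at hab
  have hsq : c ^ 2 ≠ 1 := fun h => hc1 ((pow_eq_one_iff_of_nonneg hc.le two_ne_zero).1 h)
  have hdiff : 1 - c ^ 2 ≠ 0 := sub_ne_zero.2 hsq.symm
  have hS : 0 < ∑ i ∈ Finset.range (m + 1), (c ^ 2) ^ i := by positivity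
  obtain ⟨hp, hq⟩ := pN_qN_eq hA hc hc1 m
  rw [hp, hq]
  constructor <;> refine mul_neg_of_pos_of_neg (by positivity) (sub_neg.2 ?_)
  · rw [div_lt_div_iff₀ (by positivity) (by positivity)]
    calc c ^ m * (c ^ m * (m + 1) ^ 2) = ((m + 1) * c ^ m) ^ 2 := by ring
      _ < (∑ i ∈ Finset.range (m + 1), (c ^ 2) ^ i) ^ 2 :=
        pow_lt_pow_left₀ (mul_pow_lt_geom_sum_sq hc hc1 hm) (by positivity) two_ne_zero
      _ = 1 * _ := (one_mul _).symm
  · rw [div_lt_div_iff₀ (by positivity) (by positivity)]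
    linarith [mul_geom_sum_sq_lt (x := c ^ 2) (by positivity) hsq hm]
end

section
/- For every a > 0, the limit as b → a (b > 0, b ≠ a) of p_N(a,b) equals −(1/(6a²))(1 − 1/N²), and the limit as b → a of q_N(a,b) equals −(1/(3a²))(1 − 3/(2N) + 1/(2N²)). -/
open Real Filter

lemma tendsto_sinh_sub_self_div_cube :
    Tendsto (fun x : ℝ => (sinh x - x) / x^3) (nhdsWithin 0 {0}ᶜ) (nhds (1/6)) := by
  have h1 := Real.exp_sub_sum_range_succ_isLittleO_pow 3
  have hneg : Tendsto (fun x : ℝ => -x) (nhds 0) (nhds 0) := by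
    simpa using (continuous_neg (G := ℝ)).tendsto 0
  have h2 := h1.comp_tendsto hneg
  have t1 := (h1.mono (nhdsWithin_le_nhds (s := {0}ᶜ))).tendsto_div_nhds_zero
  have t2 := (h2.mono (nhdsWithin_le_nhds (s := {0}ᶜ))).tendsto_div_nhds_zero
  have t := ((t1.add t2).div_const 2).add_const (1/6)
  norm_num at t
  refine (t.congr' ?_).trans (by norm_num)
  filter_upwards [self_mem_nhdsWithin] with x hx
  have hx : x ≠ 0 := hx
  simp only [Finset.sum_range_succ, Finset.sum_range_zero, Nat.factorial, Real.sinh_eq]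
  push_cast
  field_simp
  ring

lemma tendsto_sinh_div_self :
    Tendsto (fun x : ℝ => sinh x / x) (nhdsWithin 0 {0}ᶜ) (nhds 1) := by
  have h := (Real.hasDerivAt_sinh 0).tendsto_slope
  rw [Real.cosh_zero] at h
  refine h.congr fun x => ?_
  simp [slope_def_field]

lemma tendsto_cosh_sub_one_div_self :
    Tendsto (fun x : ℝ => (cosh x - 1) / x) (nhdsWithin 0 {0}ᶜ) (nhds 0) := by
  have h := (Real.hasDerivAt_cosh 0).tendsto_slope
  rw [Real.sinh_zero] at h
  refine h.congr fun x => ?_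
  simp [slope_def_field]

lemma tendsto_one_div_sinh_sq_sub :
    Tendsto (fun x : ℝ => 1 / sinh x ^ 2 - 1 / x^2) (nhdsWithin 0 {0}ᶜ) (nhds (-(1/3))) := by
  have t := (tendsto_sinh_sub_self_div_cube.neg.mul (tendsto_sinh_div_self.add_const 1)).div
    (tendsto_sinh_div_self.pow 2) (by norm_num)
  norm_num at t
  refine (t.congr' ?_).trans (by norm_num)
  filter_upwards [self_mem_nhdsWithin] with x hx
  have hx : x ≠ 0 := hx
  have hs : sinh x ≠ 0 := Real.sinh_ne_zero.2 hx
  simp only [Pi.div_apply]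
  field_simp
  ring

lemma tendsto_cosh_div_sinh_sub :
    Tendsto (fun x : ℝ => cosh x / sinh x - 1 / x) (nhdsWithin 0 {0}ᶜ) (nhds 0) := by
  have hid : Tendsto (fun x : ℝ => x) (nhdsWithin 0 {0}ᶜ) (nhds 0) :=
    tendsto_id.mono_left nhdsWithin_le_nhds
  have t := (tendsto_cosh_sub_one_div_self.sub (hid.mul tendsto_sinh_sub_self_div_cube)).div
    tendsto_sinh_div_self one_ne_zero
  norm_num at t
  refine t.congr' ?_
  filter_upwards [self_mem_nhdsWithin] with x hx
  have hx : x ≠ 0 := hx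
  have hs : sinh x ≠ 0 := Real.sinh_ne_zero.2 hx
  simp only [Pi.div_apply]
  field_simp
  ring

lemma one_sub_exp_neg_two_mul (x : ℝ) : 1 - exp (-(2 * x)) = 2 * exp (-x) * sinh x := by
  rw [Real.sinh_eq, show -(2 * x) = -x + -x by ring, Real.exp_add, Real.exp_neg]
  field_simp

lemma sq_sub_mul_exp_neg_sq (a s : ℝ) :
    a^2 - (a * exp (-s))^2 = a^2 * (2 * exp (-s) * sinh s) := by
  rw [← one_sub_exp_neg_two_mul, show -(2 * s) = -s + -s by ring, Real.exp_add]
  ring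

lemma mul_exp_neg_rpow_two_div (N : ℕ) (a s : ℝ) (ha : 0 < a) :
    (a * exp (-s))^((2:ℝ)/N) = a^((2:ℝ)/N) * exp (-(s/N))^2 := by
  rw [Real.mul_rpow ha.le (exp_pos _).le, ← Real.exp_mul, ← Real.exp_nat_mul]
  congr 2
  push_cast
  ring

lemma rpow_sub_mul_exp_neg_rpow (N : ℕ) (a s : ℝ) (ha : 0 < a) :
    a^((2:ℝ)/N) - (a * exp (-s))^((2:ℝ)/N)
      = a^((2:ℝ)/N) * (2 * exp (-(s/N)) * sinh (s/N)) := by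
  rw [mul_exp_neg_rpow_two_div N a s ha, ← one_sub_exp_neg_two_mul,
    show -(2 * (s/N)) = -(s/N) + -(s/N) by ring, Real.exp_add]
  ring

lemma pN_mul_exp_neg (N : ℕ) (hN : N ≠ 0) (a s : ℝ) (ha : 0 < a) (hs : s ≠ 0) :
    pN N a (a * exp (-s)) = exp s / (2 * a^2) *
      ((1 / sinh s ^ 2 - 1 / s^2) - (1 / sinh (s/N) ^ 2 - 1 / (s/N)^2) / N^2) := by
  have hN' : (N : ℝ) ≠ 0 := Nat.cast_ne_zero.2 hN
  have hss : sinh s ≠ 0 := Real.sinh_ne_zero.2 hs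
  have hsy : sinh (s/N) ≠ 0 := Real.sinh_ne_zero.2 (div_ne_zero hs hN')
  have hA : a^((2:ℝ)/N) ≠ 0 := (rpow_pos_of_pos ha _).ne'
  have hbp : 0 < a * exp (-s) := by positivity
  rw [pN, sq_sub_mul_exp_neg_sq, rpow_sub_mul_exp_neg_rpow N a s ha, Real.rpow_sub_one ha.ne',
    Real.rpow_sub_one hbp.ne', mul_exp_neg_rpow_two_div N a s ha, Real.exp_neg, Real.exp_neg]
  field_simp
  ring

lemma qN_mul_exp_neg (N : ℕ) (hN : N ≠ 0) (a s : ℝ) (ha : 0 < a) (hs : s ≠ 0) :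
    qN N a (a * exp (-s)) = 1 / a^2 *
      (-(1/2) - (1 / sinh s ^ 2 - 1 / s^2) / 2 - (cosh s / sinh s - 1 / s) / 2
        + ((cosh (s/N) / sinh (s/N) - 1 / (s/N)) + 1) / (2 * N)
        + (1 / sinh (s/N) ^ 2 - 1 / (s/N)^2) / (2 * N^2)) := by
  have hN' : (N : ℝ) ≠ 0 := Nat.cast_ne_zero.2 hN
  have hss : sinh s ≠ 0 := Real.sinh_ne_zero.2 hs
  have hsy : sinh (s/N) ≠ 0 := Real.sinh_ne_zero.2 (div_ne_zero hs hN')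
  have hA : a^((2:ℝ)/N) ≠ 0 := (rpow_pos_of_pos ha _).ne'
  have h1 : -(a^2 + (a * exp (-s))^2) / (a^2 - (a * exp (-s))^2)^2
      = 1 / a^2 * (-(1/2) - 1 / sinh s ^ 2 / 2 - cosh s / sinh s / 2) := by
    have hsum : a^2 + (a * exp (-s))^2 = a^2 * (2 * exp (-s) * cosh s) := by
      rw [Real.cosh_eq, Real.exp_neg]
      field_simp
    rw [hsum, sq_sub_mul_exp_neg_sq, Real.exp_neg, ← Real.cosh_add_sinh]
    have hcs : cosh s + sinh s ≠ 0 := by rw [Real.cosh_add_sinh]; exact (exp_pos s).ne'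
    field_simp
    linear_combination -Real.cosh_sq s
  have h2 : ((N:ℝ) * (2 * exp (-(s/N)) * sinh (s/N)) + 2 * exp (-(s/N))^2)
        / ((N:ℝ) * (2 * exp (-(s/N)) * sinh (s/N)))^2
      = (cosh (s/N) / sinh (s/N) + 1) / (2 * N) + 1 / sinh (s/N) ^ 2 / (2 * N^2) := by
    rw [Real.exp_neg, ← Real.cosh_add_sinh]
    have hcs : cosh (s/N) + sinh (s/N) ≠ 0 := by rw [Real.cosh_add_sinh]; exact (exp_pos _).ne'
    field_simp
  have h3 : a^((2:ℝ)/N - 2) = a^((2:ℝ)/N) / a^2 := by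
    rw [Real.rpow_sub ha, Real.rpow_two]
  have h4 : qN N a (a * exp (-s)) = -(a^2 + (a * exp (-s))^2) / (a^2 - (a * exp (-s))^2)^2
      + 1 / a^2 * (((N:ℝ) * (2 * exp (-(s/N)) * sinh (s/N)) + 2 * exp (-(s/N))^2)
        / ((N:ℝ) * (2 * exp (-(s/N)) * sinh (s/N)))^2) := by
    rw [qN, rpow_sub_mul_exp_neg_rpow N a s ha, mul_exp_neg_rpow_two_div N a s ha, h3]
    field_simp
  rw [h4, h1, h2]
  field_simp
  ring

/-- As `b → a` (with `b > 0`, `b ≠ a`), `p_N(a,b) → −(1/(6a²))(1 − 1/N²)` and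
`q_N(a,b) → −(1/(3a²))(1 − 3/(2N) + 1/(2N²))`. -/
theorem stmt5 (N : ℕ) (hN : 2 ≤ N) (a : ℝ) (ha : 0 < a) :
    Tendsto (fun b : ℝ => pN N a b) (nhdsWithin a {b : ℝ | 0 < b ∧ b ≠ a})
      (nhds (-(1/(6*a^2)) * (1 - 1/(N:ℝ)^2))) ∧
    Tendsto (fun b : ℝ => qN N a b) (nhdsWithin a {b : ℝ | 0 < b ∧ b ≠ a})
      (nhds (-(1/(3*a^2)) * (1 - 3/(2*(N:ℝ)) + 1/(2*(N:ℝ)^2)))) := by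
  have hN0 : N ≠ 0 := by omega
  have hN' : (N : ℝ) ≠ 0 := Nat.cast_ne_zero.2 hN0
  have hs : Tendsto (fun b : ℝ => log (a / b)) (nhdsWithin a {b : ℝ | 0 < b ∧ b ≠ a})
      (nhdsWithin 0 {0}ᶜ) := by
    refine tendsto_nhdsWithin_iff.2 ⟨?_, ?_⟩
    · have hc : ContinuousAt (fun b : ℝ => log (a / b)) a :=
        (continuousAt_const.div continuousAt_id ha.ne').log (by simp [ha.ne'])
      have := hc.tendsto
      rw [div_self ha.ne', Real.log_one] at this
      exact this.mono_left nhdsWithin_le_nhds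
    · filter_upwards [self_mem_nhdsWithin] with b hb
      refine Real.log_ne_zero_of_pos_of_ne_one (div_pos ha hb.1) fun h => hb.2 ?_
      exact ((div_eq_one_iff_eq hb.1.ne').1 h).symm
  have hy : Tendsto (fun s : ℝ => s / N) (nhdsWithin 0 {0}ᶜ) (nhdsWithin 0 {0}ᶜ) := by
    refine tendsto_nhdsWithin_iff.2 ⟨?_, ?_⟩
    · have := (continuous_id.div_const (N : ℝ)).tendsto 0
      simp only [id, zero_div] at this
      exact this.mono_left nhdsWithin_le_nhds
    · filter_upwards [self_mem_nhdsWithin] with s hs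
      exact div_ne_zero hs hN'
  have hab : ∀ᶠ b in nhdsWithin a {b : ℝ | 0 < b ∧ b ≠ a}, a * exp (-log (a / b)) = b := by
    filter_upwards [self_mem_nhdsWithin] with b hb
    have := hb.1.ne'
    rw [Real.exp_neg, Real.exp_log (div_pos ha hb.1)]
    field_simp
  have hS := tendsto_one_div_sinh_sq_sub
  have hC := tendsto_cosh_div_sinh_sub
  have hexp : Tendsto exp (nhdsWithin 0 {0}ᶜ) (nhds 1) := by
    have := Real.continuous_exp.tendsto 0
    rw [Real.exp_zero] at this
    exact this.mono_left nhdsWithin_le_nhds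
  constructor
  · have t : Tendsto (fun s => pN N a (a * exp (-s))) (nhdsWithin 0 {0}ᶜ)
        (nhds (-(1/(6*a^2)) * (1 - 1/(N:ℝ)^2))) := by
      have t := (hexp.div_const (2 * a^2)).mul (hS.sub ((hS.comp hy).div_const ((N:ℝ)^2)))
      refine (t.congr' ?_).trans (le_of_eq (congrArg nhds ?_))
      · filter_upwards [self_mem_nhdsWithin] with s hs
        exact (pN_mul_exp_neg N hN0 a s ha hs).symm
      · field_simp
        ring
    refine (t.comp hs).congr' ?_
    filter_upwards [hab] with b hb
    simp only [Function.comp, hb]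
  · have t : Tendsto (fun s => qN N a (a * exp (-s))) (nhdsWithin 0 {0}ᶜ)
        (nhds (-(1/(3*a^2)) * (1 - 3/(2*(N:ℝ)) + 1/(2*(N:ℝ)^2)))) := by
      have t := (((((hS.div_const 2).const_sub (-(1/2))).sub (hC.div_const 2)).add
        (((hC.comp hy).add_const 1).div_const (2 * (N:ℝ)))).add
        ((hS.comp hy).div_const (2 * (N:ℝ)^2))).const_mul (1 / a^2)
      refine (t.congr' ?_).trans (le_of_eq (congrArg nhds ?_))
      · filter_upwards [self_mem_nhdsWithin] with s hs
        exact (qN_mul_exp_neg N hN0 a s ha hs).symm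
      · field_simp
        ring
    refine (t.comp hs).congr' ?_
    filter_upwards [hab] with b hb
    simp only [Function.comp, hb]
end

section
/- If (N, d) ≠ (2, 2), then the DLN entropy S_N is strictly concave on the convex set S_d = {σ ∈ ℝ^d : σ_1 ≥ σ_2 ≥ ⋯ ≥ σ_d > 0} (equivalently, its Euclidean Hessian is negative definite at every point of S_d). -/
open Real Finset

/-- The chamber `S_d = {σ ∈ ℝ^d : σ_1 ≥ σ_2 ≥ ⋯ ≥ σ_d > 0}`. -/
def chamber (d : ℕ) : Set (Fin d → ℝ) :=
  {σ | (∀ i, 0 < σ i) ∧ ∀ i j : Fin d, i ≤ j → σ j ≤ σ i}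

/-- The average of the `r`-th power over the segment between `x` and `y`. -/
noncomputable def segmentMean (r x y : ℝ) : ℝ := ∫ s in (0:ℝ)..1, (s * x + (1 - s) * y) ^ r

lemma segment_pos {x y s : ℝ} (hx : 0 < x) (hy : 0 < y) (hs : s ∈ Set.Icc (0:ℝ) 1) :
    0 < s * x + (1 - s) * y := by
  obtain ⟨h0, h1⟩ := hs
  rcases h0.eq_or_lt with rfl | h
  · simpa using hy
  · have := mul_pos h hx
    have := mul_nonneg (sub_nonneg.2 h1) hy.le
    linarith

lemma continuousOn_segment_rpow (r : ℝ) {x y : ℝ} (hx : 0 < x) (hy : 0 < y) :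
    ContinuousOn (fun s : ℝ => (s * x + (1 - s) * y) ^ r) (Set.Icc 0 1) :=
  ContinuousOn.rpow_const (by fun_prop) fun _ hs => Or.inl (segment_pos hx hy hs).ne'

lemma intervalIntegrable_segment_rpow (r : ℝ) {x y : ℝ} (hx : 0 < x) (hy : 0 < y) :
    IntervalIntegrable (fun s : ℝ => (s * x + (1 - s) * y) ^ r) MeasureTheory.volume 0 1 :=
  ContinuousOn.intervalIntegrable_of_Icc zero_le_one (continuousOn_segment_rpow r hx hy)

lemma segmentMean_pos (r : ℝ) {x y : ℝ} (hx : 0 < x) (hy : 0 < y) : 0 < segmentMean r x y :=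
  intervalIntegral.intervalIntegral_pos_of_pos_on (intervalIntegrable_segment_rpow r hx hy)
    (fun _ hs => rpow_pos_of_pos (segment_pos hx hy (Set.Ioo_subset_Icc_self hs)) r) zero_lt_one

lemma segmentMean_self (r x : ℝ) : segmentMean r x x = x ^ r := by
  have h : ∀ s : ℝ, s * x + (1 - s) * x = x := fun s => by ring
  simp [segmentMean, h]

lemma rpow_sub_rpow_eq_segmentMean (q : ℝ) {x y : ℝ} (hx : 0 < x) (hy : 0 < y) :
    x ^ q - y ^ q = (x - y) * (q * segmentMean (q - 1) x y) := by
  have key : ∫ s in (0:ℝ)..1, (x - y) * q * (s * x + (1 - s) * y) ^ (q - 1) =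
      (1 * x + (1 - 1) * y) ^ q - (0 * x + (1 - 0) * y) ^ q := by
    refine intervalIntegral.integral_eq_sub_of_hasDerivAt
      (f := fun s : ℝ => (s * x + (1 - s) * y) ^ q) (fun s hs => ?_)
      ((intervalIntegrable_segment_rpow (q - 1) hx hy).const_mul _)
    rw [Set.uIcc_of_le zero_le_one] at hs
    have h : HasDerivAt (fun s : ℝ => s * x + (1 - s) * y) (x - y) s := by
      have h' := ((hasDerivAt_id' s).mul_const x).add
        (((hasDerivAt_id' s).const_sub 1).mul_const y)
      rw [one_mul, neg_one_mul, ← sub_eq_add_neg] at h'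
      exact h'
    exact h.rpow_const (Or.inl (segment_pos hx hy hs).ne')
  rw [intervalIntegral.integral_const_mul] at key
  simp only [one_mul, sub_self, zero_mul, add_zero, sub_zero, zero_add] at key
  rw [segmentMean, ← key]
  ring

lemma log_convex_comb_le {a b u v : ℝ} (ha : 0 < a) (hb : 0 < b) (hab : a + b = 1)
    (hu : 0 < u) (hv : 0 < v) : a * log u + b * log v ≤ log (a * u + b * v) :=
  strictConcaveOn_log_Ioi.concaveOn.2 hu hv ha.le hb.le hab

lemma log_convex_comb_lt {a b u v : ℝ} (ha : 0 < a) (hb : 0 < b) (hab : a + b = 1)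
    (hu : 0 < u) (hv : 0 < v) (huv : u ≠ v) : a * log u + b * log v < log (a * u + b * v) :=
  strictConcaveOn_log_Ioi.2 hu hv huv ha hb hab

/-- For `r < 0` the segment mean is strictly log-convex. -/
lemma log_segmentMean_lt {r a b x y x' y' : ℝ} (hr : r < 0) (ha : 0 < a) (hb : 0 < b)
    (hab : a + b = 1) (hx : 0 < x) (hy : 0 < y) (hx' : 0 < x') (hy' : 0 < y')
    (hne : x ≠ x' ∨ y ≠ y') :
    log (segmentMean r (a * x + b * x') (a * y + b * y')) <
      a * log (segmentMean r x y) + b * log (segmentMean r x' y') := by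
  have hX : 0 < a * x + b * x' := by positivity
  have hY : 0 < a * y + b * y' := by positivity
  set U := segmentMean r x y with hU
  set V := segmentMean r x' y' with hV
  have hU0 : 0 < U := segmentMean_pos r hx hy
  have hV0 : 0 < V := segmentMean_pos r hx' hy'
  set w := a * log U + b * log V with hw
  have hexp : ∀ {W l : ℝ}, 0 < W → 0 < l → exp (log l * r - log W) = l ^ r / W := by
    intro W l hW hl
    rw [exp_sub, exp_log hW, rpow_def_of_pos hl]
  have hcomb : ∀ s : ℝ, s * (a * x + b * x') + (1 - s) * (a * y + b * y') =
      a * (s * x + (1 - s) * y) + b * (s * x' + (1 - s) * y') := fun s => by ring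
  have hconv : ∀ s ∈ Set.Icc (0:ℝ) 1,
      exp (a * (log (s * x + (1 - s) * y) * r - log U)
        + b * (log (s * x' + (1 - s) * y') * r - log V)) ≤
      a * ((s * x + (1 - s) * y) ^ r / U) + b * ((s * x' + (1 - s) * y') ^ r / V) := by
    intro s hs
    rw [← hexp hU0 (segment_pos hx hy hs), ← hexp hV0 (segment_pos hx' hy' hs)]
    exact convexOn_exp.2 (Set.mem_univ _) (Set.mem_univ _) ha.le hb.le hab
  have hlhs : ∀ s ∈ Set.Icc (0:ℝ) 1,
      (s * (a * x + b * x') + (1 - s) * (a * y + b * y')) ^ r =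
      exp w * exp (log (a * (s * x + (1 - s) * y) + b * (s * x' + (1 - s) * y')) * r - w) := by
    intro s hs
    rw [rpow_def_of_pos (segment_pos hX hY hs), hcomb, ← exp_add]
    ring_nf
  have hle : ∀ s ∈ Set.Icc (0:ℝ) 1,
      (s * (a * x + b * x') + (1 - s) * (a * y + b * y')) ^ r ≤
      exp w * (a * ((s * x + (1 - s) * y) ^ r / U) + b * ((s * x' + (1 - s) * y') ^ r / V)) := by
    intro s hs
    rw [hlhs s hs]
    refine mul_le_mul_of_nonneg_left (le_trans (exp_le_exp.2 ?_) (hconv s hs)) (exp_pos w).le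
    have := log_convex_comb_le ha hb hab (segment_pos hx hy hs) (segment_pos hx' hy' hs)
    have := mul_le_mul_of_nonpos_right this hr.le
    linarith
  have hlt : ∀ s ∈ Set.Icc (0:ℝ) 1, s * x + (1 - s) * y ≠ s * x' + (1 - s) * y' →
      (s * (a * x + b * x') + (1 - s) * (a * y + b * y')) ^ r <
      exp w * (a * ((s * x + (1 - s) * y) ^ r / U) + b * ((s * x' + (1 - s) * y') ^ r / V)) := by
    intro s hs hn
    rw [hlhs s hs]
    refine mul_lt_mul_of_pos_left (lt_of_lt_of_le (exp_lt_exp.2 ?_) (hconv s hs)) (exp_pos w)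
    have := log_convex_comb_lt ha hb hab (segment_pos hx hy hs) (segment_pos hx' hy' hs) hn
    have := mul_lt_mul_of_neg_right this hr
    linarith
  have hint : segmentMean r (a * x + b * x') (a * y + b * y') < ∫ s in (0:ℝ)..1,
      exp w * (a * ((s * x + (1 - s) * y) ^ r / U) + b * ((s * x' + (1 - s) * y') ^ r / V)) := by
    refine intervalIntegral.integral_lt_integral_of_continuousOn_of_le_of_exists_lt zero_lt_one
      (continuousOn_segment_rpow r hX hY) ?_ (fun s hs => hle s (Set.Ioc_subset_Icc_self hs)) ?_
    · exact continuousOn_const.mul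
        ((continuousOn_const.mul ((continuousOn_segment_rpow r hx hy).div_const U)).add
          (continuousOn_const.mul ((continuousOn_segment_rpow r hx' hy').div_const V)))
    · rcases hne with h | h
      · exact ⟨1, by simp, hlt 1 (by simp) (by simpa using h)⟩
      · exact ⟨0, by simp, hlt 0 (by simp) (by simpa using h)⟩
  have heq : ∫ s in (0:ℝ)..1,
      exp w * (a * ((s * x + (1 - s) * y) ^ r / U) + b * ((s * x' + (1 - s) * y') ^ r / V)) =
      exp w := by
    rw [intervalIntegral.integral_const_mul, intervalIntegral.integral_add
      (((intervalIntegrable_segment_rpow r hx hy).div_const U).const_mul a)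
      (((intervalIntegrable_segment_rpow r hx' hy').div_const V).const_mul b),
      intervalIntegral.integral_const_mul, intervalIntegral.integral_const_mul,
      intervalIntegral.integral_div, intervalIntegral.integral_div]
    change exp w * (a * (U / U) + b * (V / V)) = _
    rw [div_self hU0.ne', div_self hV0.ne', mul_one, mul_one, hab, mul_one]
  rw [heq] at hint
  exact (log_lt_iff_lt_exp (segmentMean_pos r hX hY)).2 hint

lemma Phi_mul_sub (N : ℕ) (a b : ℝ) :
    Phi N a b * (a ^ 2 - b ^ 2) = (a ^ 2) ^ N - (b ^ 2) ^ N := by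
  rw [← Commute.geom_sum₂_mul (Commute.all (a ^ 2) (b ^ 2)), Phi, ← Finset.sum_range_reflect]
  congr 1
  refine Finset.sum_congr rfl fun m hm => ?_
  have : N - 1 - (N - 1 - m) = m := by have := Finset.mem_range.1 hm; omega
  rw [this, pow_mul, pow_mul]

lemma Phi_self (N : ℕ) (a : ℝ) : Phi N a a = N * (a ^ 2) ^ (N - 1) := by
  rw [Phi, Finset.sum_congr rfl (g := fun _ => (a ^ 2) ^ (N - 1))]
  · simp
  · intro m hm
    have : 2 * (N - 1 - m) + 2 * m = 2 * (N - 1) := by have := Finset.mem_range.1 hm; omega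
    rw [← pow_add, this, pow_mul]

lemma Phi_mul_segmentMean {N : ℕ} (hN : N ≠ 0) {x y : ℝ} (hx : 0 < x) (hy : 0 < y) :
    Phi N (x ^ ((1:ℝ) / N)) (y ^ ((1:ℝ) / N)) * (2 / N * segmentMean (2 / N - 1) x y) = x + y := by
  have hN' : (N:ℝ) ≠ 0 := by exact_mod_cast hN
  have hsq : ∀ {z : ℝ}, 0 < z → (z ^ ((1:ℝ) / N)) ^ 2 = z ^ ((2:ℝ) / N) := by
    intro z hz
    rw [← rpow_natCast, ← rpow_mul hz.le]
    congr 1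
    push_cast
    ring
  have hpow : ∀ {z : ℝ}, 0 < z → (z ^ ((2:ℝ) / N)) ^ N = z ^ 2 := by
    intro z hz
    rw [← rpow_natCast, ← rpow_mul hz.le, div_mul_cancel₀ _ hN', rpow_ofNat]
  rcases eq_or_ne x y with rfl | hne
  · have h1 : (x ^ ((2:ℝ) / N)) ^ (N - 1) * x ^ ((2:ℝ) / N) = x ^ 2 := by
      rw [← pow_succ, Nat.sub_add_cancel (Nat.one_le_iff_ne_zero.2 hN), hpow hx]
    rw [Phi_self, segmentMean_self, hsq hx, rpow_sub_one hx.ne']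
    field_simp
    linear_combination 2 * h1
  · have h := Phi_mul_sub N (x ^ ((1:ℝ) / N)) (y ^ ((1:ℝ) / N))
    rw [hsq hx, hsq hy, hpow hx, hpow hy, rpow_sub_rpow_eq_segmentMean _ hx hy] at h
    refine mul_left_cancel₀ (sub_ne_zero.2 hne) ?_
    linear_combination h

lemma log_Phi {N : ℕ} (hN : N ≠ 0) {x y : ℝ} (hx : 0 < x) (hy : 0 < y) :
    log (Phi N (x ^ ((1:ℝ) / N)) (y ^ ((1:ℝ) / N))) =
      log (x + y) - log (2 / N) - log (segmentMean (2 / N - 1) x y) := by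
  have hq : (2:ℝ) / N ≠ 0 := div_ne_zero two_ne_zero (by exact_mod_cast hN)
  have hK := (segmentMean_pos (2 / N - 1) hx hy).ne'
  rw [eq_div_of_mul_eq (mul_ne_zero hq hK) (Phi_mul_segmentMean hN hx hy),
    log_div (add_pos hx hy).ne' (mul_ne_zero hq hK), log_mul hq hK]
  ring

lemma log_Phi_two {x y : ℝ} (hx : 0 < x) (hy : 0 < y) :
    log (Phi 2 (x ^ ((1:ℝ) / (2:ℕ))) (y ^ ((1:ℝ) / (2:ℕ)))) = log (x + y) := by
  rw [log_Phi two_ne_zero hx hy]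
  simp [segmentMean]

lemma log_Phi_lt_of_three_le {N : ℕ} (hN : 3 ≤ N) {a b x y x' y' : ℝ} (ha : 0 < a) (hb : 0 < b)
    (hab : a + b = 1) (hx : 0 < x) (hy : 0 < y) (hx' : 0 < x') (hy' : 0 < y')
    (hne : x ≠ x' ∨ y ≠ y') :
    a * log (Phi N (x ^ ((1:ℝ) / N)) (y ^ ((1:ℝ) / N))) +
      b * log (Phi N (x' ^ ((1:ℝ) / N)) (y' ^ ((1:ℝ) / N))) <
    log (Phi N ((a * x + b * x') ^ ((1:ℝ) / N)) ((a * y + b * y') ^ ((1:ℝ) / N))) := by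
  have hN0 : N ≠ 0 := by omega
  have hr : (2:ℝ) / N - 1 < 0 := by
    have h3 : (3:ℝ) ≤ N := by exact_mod_cast hN
    rw [sub_neg, div_lt_one (by linarith)]
    linarith
  rw [log_Phi hN0 hx hy, log_Phi hN0 hx' hy', log_Phi hN0 (by positivity) (by positivity)]
  have h1 := log_segmentMean_lt hr ha hb hab hx hy hx' hy' hne
  have h2 := log_convex_comb_le ha hb hab (add_pos hx hy) (add_pos hx' hy')
  have h3 : a * (x + y) + b * (x' + y') = a * x + b * x' + (a * y + b * y') := by ring
  rw [h3] at h2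
  have h4 : a * log ((2:ℝ) / N) + b * log ((2:ℝ) / N) = log ((2:ℝ) / N) := by
    rw [← add_mul, hab, one_mul]
  linarith

lemma log_Phi_two_lt {a b x y x' y' : ℝ} (ha : 0 < a) (hb : 0 < b)
    (hab : a + b = 1) (hx : 0 < x) (hy : 0 < y) (hx' : 0 < x') (hy' : 0 < y')
    (hne : x + y ≠ x' + y') :
    a * log (Phi 2 (x ^ ((1:ℝ) / (2:ℕ))) (y ^ ((1:ℝ) / (2:ℕ)))) +
      b * log (Phi 2 (x' ^ ((1:ℝ) / (2:ℕ))) (y' ^ ((1:ℝ) / (2:ℕ)))) <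
    log (Phi 2 ((a * x + b * x') ^ ((1:ℝ) / (2:ℕ))) ((a * y + b * y') ^ ((1:ℝ) / (2:ℕ)))) := by
  rw [log_Phi_two hx hy, log_Phi_two hx' hy', log_Phi_two (by positivity) (by positivity)]
  have h3 : a * x + b * x' + (a * y + b * y') = a * (x + y) + b * (x' + y') := by ring
  rw [h3]
  exact log_convex_comb_lt ha hb hab (add_pos hx hy) (add_pos hx' hy') hne

lemma log_Phi_le {N : ℕ} (hN : 2 ≤ N) {a b x y x' y' : ℝ} (ha : 0 < a) (hb : 0 < b)
    (hab : a + b = 1) (hx : 0 < x) (hy : 0 < y) (hx' : 0 < x') (hy' : 0 < y') :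
    a * log (Phi N (x ^ ((1:ℝ) / N)) (y ^ ((1:ℝ) / N))) +
      b * log (Phi N (x' ^ ((1:ℝ) / N)) (y' ^ ((1:ℝ) / N))) ≤
    log (Phi N ((a * x + b * x') ^ ((1:ℝ) / N)) ((a * y + b * y') ^ ((1:ℝ) / N))) := by
  rcases hN.eq_or_lt with rfl | hN
  · rw [log_Phi_two hx hy, log_Phi_two hx' hy', log_Phi_two (by positivity) (by positivity)]
    have h3 : a * x + b * x' + (a * y + b * y') = a * (x + y) + b * (x' + y') := by ring
    rw [h3]
    exact log_convex_comb_le ha hb hab (add_pos hx hy) (add_pos hx' hy')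
  · by_cases hne : x ≠ x' ∨ y ≠ y'
    · exact (log_Phi_lt_of_three_le hN ha hb hab hx hy hx' hy' hne).le
    · obtain ⟨rfl, rfl⟩ : x = x' ∧ y = y' := by simpa [not_or] using hne
      simp only [← add_mul, hab, one_mul, le_refl]

lemma exists_ne_pair {d : ℕ} (hd : 2 ≤ d) {x y : Fin d → ℝ} (hxy : x ≠ y) :
    ∃ j k : Fin d, j < k ∧ (x j ≠ y j ∨ x k ≠ y k) := by
  obtain ⟨i, hi⟩ := Function.ne_iff.1 hxy
  have : Nontrivial (Fin d) := Fin.nontrivial_iff_two_le.2 hd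
  obtain ⟨k, hk⟩ := exists_ne i
  rcases lt_or_gt_of_ne hk with h | h
  · exact ⟨k, i, h, Or.inr hi⟩
  · exact ⟨i, k, h, Or.inl hi⟩

lemma exists_add_ne_add_pair {d : ℕ} (hd : 3 ≤ d) {x y : Fin d → ℝ} (hxy : x ≠ y) :
    ∃ j k : Fin d, j < k ∧ x j + x k ≠ y j + y k := by
  by_contra! h
  have h' : ∀ j k : Fin d, j ≠ k → x j + x k = y j + y k := by
    intro j k hjk
    rcases lt_or_gt_of_ne hjk with hlt | hlt
    · exact h j k hlt
    · linarith [h k j hlt]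
  obtain ⟨i, hi⟩ := Function.ne_iff.1 hxy
  obtain ⟨j, hj⟩ : ∃ j, j ∉ ({i} : Finset (Fin d)) :=
    Finset.exists_mem_notMem_of_card_lt_card (s := {i}) (t := Finset.univ)
      (by simp; omega) |>.imp fun _ h => h.2
  obtain ⟨k, hk⟩ : ∃ k, k ∉ ({i, j} : Finset (Fin d)) :=
    Finset.exists_mem_notMem_of_card_lt_card (s := {i, j}) (t := Finset.univ)
      (by
        have := Finset.card_le_two (a := i) (b := j)
        simp only [Finset.card_univ, Fintype.card_fin]
        omega) |>.imp fun _ h => h.2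
  simp only [Finset.mem_singleton, Finset.mem_insert, not_or] at hj hk
  have h1 := h' i j (Ne.symm hj)
  have h2 := h' i k (Ne.symm hk.1)
  have h3 := h' j k (Ne.symm hk.2)
  exact hi (by linarith)

lemma convex_chamber (d : ℕ) : Convex ℝ (chamber d) := by
  intro x hx y hy a b ha hb hab
  refine ⟨fun i => ?_, fun i j hij => ?_⟩
  · have h := convex_Ioi (0:ℝ) (hx.1 i) (hy.1 i) ha hb hab
    simpa using h
  · have h1 := mul_le_mul_of_nonneg_left (hx.2 i j hij) ha
    have h2 := mul_le_mul_of_nonneg_left (hy.2 i j hij) hb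
    simpa using add_le_add h1 h2

/-- If `(N,d) ≠ (2,2)`, the DLN entropy `S_N` is strictly concave on the chamber
`S_d = {σ : σ_1 ≥ ⋯ ≥ σ_d > 0}`. -/
theorem stmt10 (N d : ℕ) (hN : 2 ≤ N) (hd : 2 ≤ d) (hNd : ¬(N = 2 ∧ d = 2))
    (c : ℝ) :
    StrictConcaveOn ℝ (chamber d) (Sent N d c) := by
  refine ⟨convex_chamber d, fun x hx y hy hxy a b ha hb hab => ?_⟩
  have hsum : a * ∑ p ∈ Finset.univ.filter (fun p : Fin d × Fin d => p.1 < p.2),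
        log (Phi N (x p.1 ^ ((1:ℝ)/N)) (x p.2 ^ ((1:ℝ)/N))) +
      b * ∑ p ∈ Finset.univ.filter (fun p : Fin d × Fin d => p.1 < p.2),
        log (Phi N (y p.1 ^ ((1:ℝ)/N)) (y p.2 ^ ((1:ℝ)/N))) <
      ∑ p ∈ Finset.univ.filter (fun p : Fin d × Fin d => p.1 < p.2),
        log (Phi N ((a * x p.1 + b * y p.1) ^ ((1:ℝ)/N))
          ((a * x p.2 + b * y p.2) ^ ((1:ℝ)/N))) := by
    rw [Finset.mul_sum, Finset.mul_sum, ← Finset.sum_add_distrib]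
    refine Finset.sum_lt_sum (fun p _ => log_Phi_le hN ha hb hab
      (hx.1 p.1) (hx.1 p.2) (hy.1 p.1) (hy.1 p.2)) ?_
    rcases hN.eq_or_lt with rfl | hN3
    · obtain ⟨j, k, hjk, hne⟩ := exists_add_ne_add_pair (by omega) hxy
      exact ⟨(j, k), by simpa using hjk, log_Phi_two_lt ha hb hab
        (hx.1 j) (hx.1 k) (hy.1 j) (hy.1 k) hne⟩
    · obtain ⟨j, k, hjk, hne⟩ := exists_ne_pair hd hxy
      exact ⟨(j, k), by simpa using hjk, log_Phi_lt_of_three_le hN3 ha hb hab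
        (hx.1 j) (hx.1 k) (hy.1 j) (hy.1 k) hne⟩
  have hc : a * c + b * c = c := by rw [← add_mul, hab, one_mul]
  simp only [Sent, smul_eq_mul, Pi.add_apply, Pi.smul_apply]
  linarith
end

section
/- Let N ≥ 2, d ≥ 2 be integers and σ⋆ > 0. Set p⋆ = −(1/(6σ⋆²))(1 − 1/N²), q⋆ = −(1/(3σ⋆²))(1 − 3/(2N) + 1/(2N²)), and χ_N = (N−1)²/(2N²σ⋆²). Let M be the d×d matrix with diagonal entries M_{ii} = (d−1)(q⋆ + χ_N) and off-diagonal entries M_{ij} = p⋆. Then M·𝟏 = θ_𝟏 𝟏 where 𝟏 = (1,…,1)ᵀ and θ_𝟏 = −((d−1)/(2σ⋆²))·((N−1)/N²) < 0, and M v = θ_⊥ v for every v ∈ ℝ^d with Σ_i v_i = 0, where θ_⊥ = (1/σ⋆²)(d/6 − (d−1)/(2N) + (2d−3)/(6N²)) > 0. In particular M is indefinite. -/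
open Matrix Finset

/-- `p⋆ = −(1/(6σ⋆²))(1 − 1/N²)`. -/
noncomputable def pstar (N : ℕ) (σs : ℝ) : ℝ := -(1/(6*σs^2)) * (1 - 1/(N:ℝ)^2)

/-- `q⋆ = −(1/(3σ⋆²))(1 − 3/(2N) + 1/(2N²))`. -/
noncomputable def qstar (N : ℕ) (σs : ℝ) : ℝ :=
  -(1/(3*σs^2)) * (1 - 3/(2*(N:ℝ)) + 1/(2*(N:ℝ)^2))

/-- `χ_N = (N−1)²/(2N²σ⋆²)`. -/
noncomputable def chiN (N : ℕ) (σs : ℝ) : ℝ := ((N:ℝ)-1)^2 / (2*(N:ℝ)^2*σs^2)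

/-- The Riemannian Hessian of the entropy at the isotropic point: diagonal entries
`(d−1)(q⋆ + χ_N)`, off-diagonal entries `p⋆`. -/
noncomputable def Mmat (N d : ℕ) (σs : ℝ) : Matrix (Fin d) (Fin d) ℝ :=
  Matrix.of fun i j =>
    if i = j then ((d:ℝ)-1) * (qstar N σs + chiN N σs) else pstar N σs

/-- With `a` the diagonal and `p` the off-diagonal entry of `M`,
`(M v)_i = (a - p) v_i + p ∑ v_j`. -/
theorem Mmat_mulVec_apply (N d : ℕ) (σs : ℝ) (v : Fin d → ℝ) (i : Fin d) :
    (Mmat N d σs *ᵥ v) i =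
      (((d:ℝ)-1) * (qstar N σs + chiN N σs) - pstar N σs) * v i
        + pstar N σs * ∑ j, v j := by
  have h : ∀ j, Mmat N d σs i j * v j =
      (if i = j then (((d:ℝ)-1) * (qstar N σs + chiN N σs) - pstar N σs) * v j else 0)
        + pstar N σs * v j := by
    intro j
    simp only [Mmat, Matrix.of_apply]
    split_ifs <;> ring
  simp only [Matrix.mulVec, dotProduct, h, Finset.sum_add_distrib, Finset.mul_sum]
  simp

/-- The matrix `M` has eigenvalue `θ_𝟏 = −((d−1)/(2σ⋆²))((N−1)/N²) < 0` on the
all-ones vector and eigenvalue `θ_⊥ = (1/σ⋆²)(d/6 − (d−1)/(2N) + (2d−3)/(6N²)) > 0`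
on the orthogonal complement `{v : Σ v_i = 0}`; in particular `M` is indefinite. -/
theorem stmt12 (N d : ℕ) (hN : 2 ≤ N) (hd : 2 ≤ d) (σs : ℝ) (hσ : 0 < σs) :
    (Mmat N d σs *ᵥ (fun _ => 1) =
      (-(((d:ℝ)-1)/(2*σs^2)) * (((N:ℝ)-1)/(N:ℝ)^2)) • (fun _ => (1:ℝ))) ∧
    (-(((d:ℝ)-1)/(2*σs^2)) * (((N:ℝ)-1)/(N:ℝ)^2) < 0) ∧
    (∀ v : Fin d → ℝ, ∑ i, v i = 0 →
      Mmat N d σs *ᵥ v =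
        ((1/σs^2) * ((d:ℝ)/6 - ((d:ℝ)-1)/(2*(N:ℝ)) + (2*(d:ℝ)-3)/(6*(N:ℝ)^2))) • v) ∧
    (0 < (1/σs^2) * ((d:ℝ)/6 - ((d:ℝ)-1)/(2*(N:ℝ)) + (2*(d:ℝ)-3)/(6*(N:ℝ)^2))) ∧
    (∃ x : Fin d → ℝ, x ⬝ᵥ (Mmat N d σs *ᵥ x) < 0) ∧
    (∃ y : Fin d → ℝ, 0 < y ⬝ᵥ (Mmat N d σs *ᵥ y)) := by
  have hN' : (2:ℝ) ≤ N := by exact_mod_cast hN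
  have hd' : (2:ℝ) ≤ d := by exact_mod_cast hd
  have hN0 : (N:ℝ) ≠ 0 := by positivity
  have hσ0 : σs ≠ 0 := hσ.ne'
  have hone : Mmat N d σs *ᵥ (fun _ => 1) =
      (-(((d:ℝ)-1)/(2*σs^2)) * (((N:ℝ)-1)/(N:ℝ)^2)) • (fun _ => (1:ℝ)) := by
    funext i
    rw [Mmat_mulVec_apply]
    simp only [Finset.sum_const, Finset.card_univ, Fintype.card_fin, nsmul_eq_mul,
      Pi.smul_apply, smul_eq_mul, qstar, chiN, pstar]
    field_simp
    ring
  have hneg : -(((d:ℝ)-1)/(2*σs^2)) * (((N:ℝ)-1)/(N:ℝ)^2) < 0 := by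
    have h1 : 0 < ((d:ℝ)-1)/(2*σs^2) := div_pos (by linarith) (by positivity)
    have h2 : 0 < ((N:ℝ)-1)/(N:ℝ)^2 := div_pos (by linarith) (by positivity)
    nlinarith [mul_pos h1 h2]
  have hperp : ∀ v : Fin d → ℝ, ∑ i, v i = 0 →
      Mmat N d σs *ᵥ v =
        ((1/σs^2) * ((d:ℝ)/6 - ((d:ℝ)-1)/(2*(N:ℝ)) + (2*(d:ℝ)-3)/(6*(N:ℝ)^2))) • v := by
    intro v hv
    funext i
    rw [Mmat_mulVec_apply, hv]
    simp only [Pi.smul_apply, smul_eq_mul, qstar, chiN, pstar]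
    field_simp
    ring
  have hpos : 0 < (1/σs^2) *
      ((d:ℝ)/6 - ((d:ℝ)-1)/(2*(N:ℝ)) + (2*(d:ℝ)-3)/(6*(N:ℝ)^2)) := by
    have h : (d:ℝ)/6 - ((d:ℝ)-1)/(2*(N:ℝ)) + (2*(d:ℝ)-3)/(6*(N:ℝ)^2)
        = ((d:ℝ) * (((N:ℝ)-1) * ((N:ℝ)-2)) + 3 * ((N:ℝ)-1)) / (6*(N:ℝ)^2) := by
      field_simp
      ring
    rw [h]
    have h1 : 0 ≤ (d:ℝ) * (((N:ℝ)-1) * ((N:ℝ)-2)) :=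
      mul_nonneg (by linarith) (mul_nonneg (by linarith) (by linarith))
    exact mul_pos (by positivity) (div_pos (by linarith) (by positivity))
  refine ⟨hone, hneg, hperp, hpos, ⟨fun _ => 1, ?_⟩, ?_⟩
  · rw [hone, dotProduct_smul, smul_eq_mul]
    refine mul_neg_of_neg_of_pos hneg ?_
    simp only [dotProduct, mul_one, Finset.sum_const, Finset.card_univ, Fintype.card_fin,
      nsmul_eq_mul]
    linarith
  · let a : Fin d := ⟨0, by omega⟩
    let b : Fin d := ⟨1, by omega⟩
    have hab : a ≠ b := by simp [a, b]
    refine ⟨Pi.single a 1 - Pi.single b 1, ?_⟩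
    rw [hperp _ (by simp [Finset.sum_sub_distrib]), dotProduct_smul, smul_eq_mul]
    refine mul_pos hpos ?_
    simp [hab, hab.symm]
end

section
/- For every integer N ≥ 2 and all a > b > 0, one has r_N(a,b) − r_N(b,a) ≤ 0, with equality if and only if N = 2. -/
open Real

/-- Bernoulli's inequality for exponents in `(-1, 0)`. -/
theorem one_add_mul_one_sub_lt_rpow_neg {p t : ℝ} (hp : 0 < p) (hp1 : p < 1) (ht : 0 < t)
    (ht1 : t < 1) : 1 + p * (1 - t) < t ^ (-p) := by
  have h := rpow_one_add_lt_one_add_mul_self (s := t - 1) (by linarith) (by linarith) hp hp1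
  rw [add_sub_cancel] at h
  rw [rpow_neg ht.le, lt_inv_comm₀ (by nlinarith) (rpow_pos_of_pos ht p)]
  refine h.trans_le ?_
  rw [← one_div, le_div_iff₀ (by nlinarith)]
  nlinarith [sq_nonneg (p * (1 - t))]

/-- The tangent line of the strictly convex function `x ↦ x ^ (-p)` lies below its graph. -/
theorem rpow_neg_add_mul_lt_rpow_neg {p x b : ℝ} (hp : 0 < p) (hp1 : p < 1) (hb : 0 < b)
    (hbx : b < x) : x ^ (-p) + p * (x - b) * x ^ (-p - 1) < b ^ (-p) := by
  have hx : 0 < x := hb.trans hbx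
  have h := one_add_mul_one_sub_lt_rpow_neg hp hp1 (div_pos hb hx) ((div_lt_one hx).2 hbx)
  rw [div_rpow hb.le hx.le, lt_div_iff₀ (rpow_pos_of_pos hx _)] at h
  rw [rpow_sub_one hx.ne']
  calc x ^ (-p) + p * (x - b) * (x ^ (-p) / x) = (1 + p * (1 - b / x)) * x ^ (-p) := by
        field_simp
    _ < b ^ (-p) := h

/-- The strict trapezoid (Hermite–Hadamard) inequality for `x ↦ x ^ (s - 1)` with `0 < s < 1`. -/
theorem two_div_mul_rpow_sub_rpow_lt {s a b : ℝ} (hs : 0 < s) (hs1 : s < 1) (hb : 0 < b)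
    (hba : b < a) :
    2 / s * (a ^ s - b ^ s) < (a - b) * (a ^ (s - 1) + b ^ (s - 1)) := by
  have hderiv : ∀ x, 0 < x → HasDerivAt
      (fun x : ℝ => (x - b) * (x ^ (s - 1) + b ^ (s - 1)) - 2 / s * (x ^ s - b ^ s))
      (b ^ (s - 1) - x ^ (s - 1) - (1 - s) * (x - b) * x ^ (s - 1 - 1)) x := by
    intro x hx
    have h1 := hasDerivAt_rpow_const (x := x) (p := s - 1) (Or.inl hx.ne')
    have h2 := hasDerivAt_rpow_const (x := x) (p := s) (Or.inl hx.ne')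
    have h3 := (((hasDerivAt_id x).sub_const b).mul (h1.add_const (b ^ (s - 1)))).sub
      ((h2.sub_const (b ^ s)).const_mul (2 / s))
    refine h3.congr_deriv ?_
    simp only [id]
    field_simp
    ring
  have hmono := strictMonoOn_of_deriv_pos (convex_Icc b a)
    (fun x hx => (hderiv x (hb.trans_le hx.1)).continuousAt.continuousWithinAt) (by
      intro x hx
      rw [interior_Icc] at hx
      rw [(hderiv x (hb.trans hx.1)).deriv]
      have h := rpow_neg_add_mul_lt_rpow_neg (p := 1 - s) (by linarith) (by linarith) hb hx.1
      rw [neg_sub] at h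
      linarith)
  have h := hmono (Set.left_mem_Icc.2 hba.le) (Set.right_mem_Icc.2 hba.le) hba
  simp only [sub_self, zero_mul, mul_zero] at h
  linarith

theorem rN_sub_rN_swap {N : ℕ} {a b : ℝ} (hN : 0 < N) (hb : 0 < b) (hba : b < a) :
    rN N a b - rN N b a = ((N : ℝ) * (a ^ ((2 : ℝ) / N) - b ^ ((2 : ℝ) / N)) -
      (a - b) * (a ^ ((2 : ℝ) / N - 1) + b ^ ((2 : ℝ) / N - 1))) /
      ((a - b) * ((N : ℝ) * (a ^ ((2 : ℝ) / N) - b ^ ((2 : ℝ) / N)))) := by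
  have hN' : (0 : ℝ) < N := Nat.cast_pos.2 hN
  have hpow : b ^ ((2 : ℝ) / N) < a ^ ((2 : ℝ) / N) := rpow_lt_rpow hb.le hba (by positivity)
  rw [rN, rN, if_neg hba.ne', if_neg hba.ne]
  generalize a ^ ((2 : ℝ) / N) = A at *
  generalize b ^ ((2 : ℝ) / N) = B at *
  have h1 : A - B ≠ 0 := (sub_pos.2 hpow).ne'
  have h2 : a - b ≠ 0 := (sub_pos.2 hba).ne'
  have h3 : a + b ≠ 0 := by linarith
  rw [← neg_sub A B, ← neg_sub (a ^ 2) (b ^ 2), sq_sub_sq]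
  field_simp
  ring

/-- For every integer `N ≥ 2` and `a > b > 0`, one has
`r_N(a,b) − r_N(b,a) ≤ 0`, with equality if and only if `N = 2`. -/
theorem stmt13 (N : ℕ) (hN : 2 ≤ N) (a b : ℝ) (hb : 0 < b) (hba : b < a) :
    rN N a b - rN N b a ≤ 0 ∧ (rN N a b - rN N b a = 0 ↔ N = 2) := by
  have hN0 : 0 < N := by omega
  have hN' : (0 : ℝ) < N := Nat.cast_pos.2 hN0
  rw [rN_sub_rN_swap hN0 hb hba]
  have hpow : b ^ ((2 : ℝ) / N) < a ^ ((2 : ℝ) / N) := rpow_lt_rpow hb.le hba (by positivity)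
  have hden : 0 < (a - b) * ((N : ℝ) * (a ^ ((2 : ℝ) / N) - b ^ ((2 : ℝ) / N))) :=
    mul_pos (sub_pos.2 hba) (mul_pos hN' (sub_pos.2 hpow))
  obtain rfl | hlt := hN.eq_or_lt
  · norm_num [mul_comm]
  · have hs1 : (2 : ℝ) / N < 1 := (div_lt_one hN').2 (by exact_mod_cast hlt)
    have h := two_div_mul_rpow_sub_rpow_lt (by positivity) hs1 hb hba
    rw [div_div_cancel₀ two_ne_zero] at h
    have hneg := div_neg_of_neg_of_pos (sub_neg.2 h) hden
    exact ⟨hneg.le, iff_of_false hneg.ne hlt.ne'⟩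
end

section
/- For every integer N ≥ 2 and every fixed b > 0, the function a ↦ r_N(a,b) (with the diagonal value r_N(b,b) = (1/(2b))(1 − 1/N)) is strictly decreasing on (0,∞). -/
open Real

namespace GeomSum

open Polynomial

/-- The polynomial `1 + X + ⋯ + X ^ (n - 1)`. -/
noncomputable def poly (n : ℕ) : ℝ[X] := ∑ i ∈ Finset.range n, X ^ i

/-- The geometric sum `1 + y + ⋯ + y ^ (n - 1)`. -/
noncomputable def val (n : ℕ) (y : ℝ) : ℝ := (poly n).eval y

/-- The derivative of the geometric sum. -/
noncomputable def val' (n : ℕ) (y : ℝ) : ℝ := (derivative (poly n)).eval y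

/-- The second derivative of the geometric sum. -/
noncomputable def val'' (n : ℕ) (y : ℝ) : ℝ := (derivative (derivative (poly n))).eval y

lemma poly_succ (n : ℕ) : poly (n + 1) = X * poly n + 1 := geom_sum_succ

lemma val_zero (y : ℝ) : val 0 y = 0 := by simp [val, poly]

lemma val'_zero (y : ℝ) : val' 0 y = 0 := by simp [val', poly]

lemma val''_zero (y : ℝ) : val'' 0 y = 0 := by simp [val'', poly]

lemma val_succ (n : ℕ) (y : ℝ) : val (n + 1) y = 1 + y * val n y := by
  simp [val, poly_succ, add_comm]

lemma val'_succ (n : ℕ) (y : ℝ) : val' (n + 1) y = val n y + y * val' n y := by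
  simp [val, val', poly_succ]

lemma val''_succ (n : ℕ) (y : ℝ) : val'' (n + 1) y = 2 * val' n y + y * val'' n y := by
  simp [val', val'', poly_succ]
  ring

lemma hasDerivAt_val (n : ℕ) (y : ℝ) : HasDerivAt (val n) (val' n y) y :=
  (poly n).hasDerivAt y

lemma hasDerivAt_val' (n : ℕ) (y : ℝ) : HasDerivAt (val' n) (val'' n y) y :=
  (derivative (poly n)).hasDerivAt y

lemma sub_one_mul_val (n : ℕ) (y : ℝ) : (y - 1) * val n y = y ^ n - 1 := by
  simpa [val, poly, eval_finsetSum] using mul_geom_sum y n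

lemma mul_val_add_sub_one_mul_val' (n : ℕ) (y : ℝ) :
    y * (val n y + (y - 1) * val' n y) = n * y ^ n := by
  induction n with
  | zero => simp [val_zero, val'_zero]
  | succ n ih =>
    rw [val_succ, val'_succ]
    push_cast
    linear_combination y * ih + y * sub_one_mul_val n y

lemma val_one (n : ℕ) : val n 1 = n := by simp [val, poly, eval_finsetSum]

lemma val'_one (n : ℕ) : val' n 1 = n * (n - 1) / 2 := by
  induction n with
  | zero => simp [val'_zero]
  | succ n ih =>
    rw [val'_succ, ih, val_one]
    push_cast
    ring

section Nonneg

variable {y : ℝ}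

lemma val_nonneg (hy : 0 ≤ y) (n : ℕ) : 0 ≤ val n y := by
  induction n with
  | zero => simp [val_zero]
  | succ n ih => rw [val_succ]; positivity

lemma val'_nonneg (hy : 0 ≤ y) (n : ℕ) : 0 ≤ val' n y := by
  induction n with
  | zero => simp [val'_zero]
  | succ n ih => have := val_nonneg hy n; rw [val'_succ]; positivity

lemma val_pos (hy : 0 ≤ y) {n : ℕ} (hn : 1 ≤ n) : 0 < val n y := by
  obtain ⟨n, rfl⟩ := Nat.exists_eq_add_of_le' hn
  have := val_nonneg hy n
  rw [val_succ]
  positivity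

lemma val'_pos (hy : 0 ≤ y) {n : ℕ} (hn : 2 ≤ n) : 0 < val' n y := by
  obtain ⟨n, rfl⟩ := Nat.exists_eq_add_of_le' (one_le_two.trans hn)
  have := val_pos hy (show 1 ≤ n by omega)
  have := val'_nonneg hy n
  rw [val'_succ]
  positivity

lemma val_le_succ (hy : 0 ≤ y) (n : ℕ) : val n y ≤ val (n + 1) y := by
  induction n with
  | zero => simp [val_succ, val_zero]
  | succ n ih => rw [val_succ, val_succ (n + 1)]; gcongr

lemma val'_le_succ (hy : 0 ≤ y) (n : ℕ) : val' n y ≤ val' (n + 1) y := by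
  induction n with
  | zero => simp [val'_succ, val'_zero, val_zero]
  | succ n ih =>
    have := val_le_succ hy n
    rw [val'_succ, val'_succ (n + 1)]; gcongr

lemma val''_le_succ (hy : 0 ≤ y) (n : ℕ) : val'' n y ≤ val'' (n + 1) y := by
  induction n with
  | zero => simp [val''_succ, val''_zero, val'_zero]
  | succ n ih =>
    have := val'_le_succ hy n
    rw [val''_succ, val''_succ (n + 1)]; gcongr

lemma val'_succ_le_sq (hy : 0 ≤ y) (n : ℕ) : val' (n + 1) y ≤ val n y ^ 2 := by
  induction n with
  | zero => simp [val'_succ, val'_zero, val_zero]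
  | succ n ih =>
    calc val' (n + 2) y = val (n + 1) y + y * val' (n + 1) y := val'_succ _ _
      _ ≤ val (n + 1) y + y * (val n y * val n y) := by rw [← sq]; gcongr
      _ ≤ val (n + 1) y + y * (val (n + 1) y * val n y) := by
        have := val_le_succ hy n
        have := val_nonneg hy n
        gcongr
      _ = val (n + 1) y ^ 2 := by
        linear_combination (-val (n + 1) y) * val_succ n y

lemma val''_succ_le (hy : 0 ≤ y) (n : ℕ) : val'' (n + 1) y ≤ 2 * val' n y * val n y := by
  induction n with
  | zero => simp [val''_succ, val''_zero, val'_zero]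
  | succ n ih =>
    calc val'' (n + 2) y = 2 * val' (n + 1) y + y * val'' (n + 1) y := val''_succ _ _
      _ ≤ 2 * val' (n + 1) y + y * (2 * val' n y * val n y) := by gcongr
      _ ≤ 2 * val' (n + 1) y + y * (2 * val' (n + 1) y * val n y) := by
        have := val'_le_succ hy n
        have := val_nonneg hy n
        gcongr
      _ = 2 * val' (n + 1) y * val (n + 1) y := by
        linear_combination (-2 * val' (n + 1) y) * val_succ n y

/-- The reciprocal of a geometric sum is strictly convex. -/
lemma val_mul_val''_lt (hy : 0 < y) {n : ℕ} (hn : 2 ≤ n) :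
    val n y * val'' n y < 2 * val' n y ^ 2 := by
  induction n, hn using Nat.le_induction with
  | base => simp [val_succ, val'_succ, val''_succ, val_zero, val'_zero, val''_zero]
  | succ n hn ih =>
    have h₁ : val' n y ≤ val n y ^ 2 := (val'_le_succ hy.le n).trans (val'_succ_le_sq hy.le n)
    have h₂ : y * val'' n y ≤ y * (2 * val' n y * val n y) := by
      have := (val''_le_succ hy.le n).trans (val''_succ_le hy.le n)
      gcongr
    have h₃ := mul_lt_mul_of_pos_left ih (sq_pos_of_pos hy)
    rw [val_succ, val'_succ, val''_succ]
    linarith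

lemma mul_val'_le (hy : 0 ≤ y) (n : ℕ) : y * val' n y ≤ (n - 1) * val n y := by
  induction n with
  | zero => simp [val_zero, val'_zero]
  | succ n ih =>
    have h := mul_le_mul_of_nonneg_left ih hy
    have hn : (0 : ℝ) ≤ n := n.cast_nonneg
    rw [val_succ, val'_succ]
    push_cast
    linarith

lemma mul_val''_le (hy : 0 ≤ y) (n : ℕ) : y * val'' n y ≤ (n - 2) * val' n y := by
  induction n with
  | zero => simp [val'_zero, val''_zero]
  | succ n ih =>
    have h := mul_le_mul_of_nonneg_left ih hy
    have h' := mul_val'_le hy n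
    rw [val'_succ, val''_succ]
    push_cast
    linarith

end Nonneg

lemma strictAntiOn_rpow_mul_val'_div_val {n : ℕ} (hn : 2 ≤ n) :
    StrictAntiOn (fun y : ℝ => y ^ (1 - (n : ℝ) / 2) * (val' n y / val n y)) (Set.Ioi 0) := by
  have hderiv (y : ℝ) (hy : 0 < y) := (hasDerivAt_rpow_const (p := 1 - (n : ℝ) / 2)
    (Or.inl hy.ne')).mul ((hasDerivAt_val' n y).div (hasDerivAt_val n y)
      (val_pos hy.le (one_le_two.trans hn)).ne')
  refine strictAntiOn_of_deriv_neg (convex_Ioi 0)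
    (fun y hy => (hderiv y hy).continuousAt.continuousWithinAt) fun y hy => ?_
  rw [interior_Ioi] at hy
  have hy : 0 < y := hy
  refine (hderiv y hy).deriv.trans_lt ?_
  have hP := val_pos hy.le (one_le_two.trans hn)
  have hpow : y ^ (1 - (n : ℝ) / 2) = y ^ (1 - (n : ℝ) / 2 - 1) * y := by
    rw [← rpow_add_one hy.ne', sub_add_cancel]
  have hsplit : (1 - (n : ℝ) / 2) * y ^ (1 - (n : ℝ) / 2 - 1) * (val' n y / val n y)
      + y ^ (1 - (n : ℝ) / 2) * ((val'' n y * val n y - val' n y * val' n y) / val n y ^ 2)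
      = y ^ (1 - (n : ℝ) / 2 - 1) / val n y ^ 2 * ((1 - (n : ℝ) / 2) * val' n y * val n y
        + y * (val'' n y * val n y - val' n y * val' n y)) := by
    rw [hpow]
    field_simp
  rw [Pi.div_apply, hsplit]
  refine mul_neg_of_pos_of_neg (by positivity) ?_
  have h₁ := mul_lt_mul_of_pos_left (val_mul_val''_lt hy hn) hy
  have h₂ := mul_le_mul_of_nonneg_right (mul_val''_le hy.le n) hP.le
  linarith

end GeomSum

open GeomSum in
lemma rN_eq_geomSum {N : ℕ} (hN : 2 ≤ N) {a b : ℝ} (ha : 0 < a) (hb : 0 < b) :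
    rN N a b = (1 / (N * b)) * (((a / b) ^ ((2 : ℝ) / N)) ^ (1 - (N : ℝ) / 2) *
      (val' N ((a / b) ^ ((2 : ℝ) / N)) / val N ((a / b) ^ ((2 : ℝ) / N)))) := by
  have hN₀ : (0 : ℝ) < N := by positivity
  rw [rN]
  split_ifs with hab
  · subst hab
    rw [div_self ha.ne', one_rpow, one_rpow, val_one, val'_one]
    field_simp
  have hab₀ : 0 < a / b := div_pos ha hb
  set y := (a / b) ^ ((2 : ℝ) / N) with hy_def
  have hy : 0 < y := by positivity
  have hyN : y ^ N = a ^ 2 / b ^ 2 := by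
    rw [hy_def, ← rpow_mul_natCast hab₀.le, div_mul_cancel₀ _ hN₀.ne', rpow_two, div_pow]
  have hy₁ : y - 1 ≠ 0 := by
    rw [sub_ne_zero]
    intro h
    rw [h, one_pow, eq_comm, div_eq_one_iff_eq (by positivity),
      pow_left_inj₀ ha.le hb.le two_ne_zero] at hyN
    exact hab hyN
  have hpow : y ^ (1 - (N : ℝ) / 2) = y * b / a := by
    rw [rpow_sub hy, rpow_one, hy_def, ← rpow_mul hab₀.le,
      show (2 : ℝ) / N * (N / 2) = 1 by field_simp, rpow_one]
    field_simp
  have hfrac : a ^ ((2 : ℝ) / N) = y * b ^ ((2 : ℝ) / N) := by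
    rw [hy_def, div_rpow ha.le hb.le, div_mul_cancel₀ _ (rpow_pos_of_pos hb _).ne']
  have hP := val_pos hy.le (one_le_two.trans hN)
  have hb₂ : 0 < b ^ ((2 : ℝ) / N) := rpow_pos_of_pos hb _
  have ha₂ : a ^ 2 = y ^ N * b ^ 2 := by rw [hyN]; field_simp
  have hfirst : a / (a ^ 2 - b ^ 2) =
      (y * (val N y + (y - 1) * val' N y) / N) / (a * ((y - 1) * val N y)) := by
    rw [mul_val_add_sub_one_mul_val', sub_one_mul_val]
    have hne : y ^ N - 1 ≠ 0 := by rw [← sub_one_mul_val]; exact mul_ne_zero hy₁ hP.ne'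
    have hne' : a ^ 2 - b ^ 2 ≠ 0 := by
      rw [ha₂, ← sub_one_mul]; exact mul_ne_zero hne (by positivity)
    rw [mul_div_cancel_left₀ _ hN₀.ne', div_eq_div_iff hne' (by positivity)]
    linear_combination -ha₂
  have hsecond : a ^ ((2 : ℝ) / N - 1) / (N * (a ^ ((2 : ℝ) / N) - b ^ ((2 : ℝ) / N))) =
      y / (a * N * (y - 1)) := by
    rw [rpow_sub_one ha.ne', hfrac, ← sub_one_mul]
    field_simp
  rw [hfirst, hsecond, hpow]
  field_simp
  ring

/-- For every integer `N ≥ 2` and fixed `b > 0`, the map `a ↦ r_N(a,b)` is strictly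
decreasing on `(0,∞)`. -/
theorem stmt14 (N : ℕ) (hN : 2 ≤ N) (b : ℝ) (hb : 0 < b) :
    StrictAntiOn (fun a => rN N a b) (Set.Ioi 0) := by
  intro a₁ ha₁ a₂ ha₂ h
  rw [Set.mem_Ioi] at ha₁ ha₂
  have hN₀ : (0 : ℝ) < N := by positivity
  have hlt : (a₁ / b) ^ ((2 : ℝ) / N) < (a₂ / b) ^ ((2 : ℝ) / N) :=
    rpow_lt_rpow (by positivity) (by gcongr) (by positivity)
  simp only [rN_eq_geomSum hN ha₁ hb, rN_eq_geomSum hN ha₂ hb]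
  exact mul_lt_mul_of_pos_left (GeomSum.strictAntiOn_rpow_mul_val'_div_val hN
    (rpow_pos_of_pos (div_pos ha₁ hb) _) (rpow_pos_of_pos (div_pos ha₂ hb) _) hlt)
    (by positivity)
end

section
/- Let N ≥ 2, d ≥ 2 be integers and β > 0. Let g : ℝ → ℝ be twice differentiable with g' > 0 and g'' ≥ 0, and let f : (0,∞) → ℝ be twice differentiable with f' ≥ 0 and f'' > 0, and suppose g'(d·f(σ))·f'(σ) → +∞ as σ → ∞. Then there is exactly one σ⋆ > 0 satisfying the balance equation g'(d·f(σ⋆))·f'(σ⋆) = β⁻¹·((d−1)/(2σ⋆))·(1 − 1/N). -/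
open Real Filter

/-- A nonnegative, continuous, strictly increasing function on `(0, ∞)` that tends to `+∞` meets
the hyperbola `C / s` exactly once. -/
theorem existsUnique_eq_div_of_strictMonoOn {L : ℝ → ℝ} {C : ℝ} (hC : 0 < C)
    (hmono : StrictMonoOn L (Set.Ioi 0)) (hcont : ContinuousOn L (Set.Ioi 0))
    (hnn : ∀ s, 0 < s → 0 ≤ L s) (hL : Tendsto L atTop atTop) :
    ∃! s : ℝ, 0 < s ∧ L s = C / s := by
  have hlt : ∀ s t, 0 < s → s < t → L s * s < L t * t := fun s t hs hst =>
    mul_lt_mul'' (hmono hs (hs.trans hst) hst) hst (hnn s hs) hs.le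
  obtain ⟨a, ha, ha1, haC⟩ : ∃ a : ℝ, 0 < a ∧ a ≤ 1 ∧ L a * a < C := by
    have h1 := hnn 1 one_pos
    have hpos : 0 < C / (L 1 + 1) := by positivity
    refine ⟨min 1 (C / (L 1 + 1)), lt_min one_pos hpos, min_le_left _ _, ?_⟩
    set a := min 1 (C / (L 1 + 1))
    have ha : 0 < a := lt_min one_pos hpos
    have hle : L a ≤ L 1 := hmono.monotoneOn ha (Set.mem_Ioi.2 one_pos) (min_le_left _ _)
    have haC : a * (L 1 + 1) ≤ C := (le_div_iff₀ (by positivity)).1 (min_le_right _ _)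
    nlinarith
  obtain ⟨b, hb, hb1⟩ := ((hL.eventually_ge_atTop C).and (eventually_ge_atTop 1)).exists
  have hcont' : ContinuousOn (fun s => L s * s) (Set.Icc a b) :=
    (hcont.mono fun x hx => ha.trans_le hx.1).mul continuousOn_id
  obtain ⟨s, hs, hsC⟩ := intermediate_value_Icc (ha1.trans hb1) hcont'
    (show C ∈ Set.Icc (L a * a) (L b * b) from ⟨haC.le, by nlinarith⟩)
  have hs0 : 0 < s := ha.trans_le hs.1
  refine ⟨s, ⟨hs0, (eq_div_iff hs0.ne').2 hsC⟩, ?_⟩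
  rintro t ⟨ht0, ht⟩
  rw [eq_div_iff ht0.ne'] at ht
  have hsC : L s * s = C := hsC
  rcases lt_trichotomy t s with h | h | h
  · linarith [hlt t s ht0 h]
  · exact h
  · linarith [hlt s t hs0 h]

/-- Existence and uniqueness of the solution `σ⋆ > 0` of the balance equation
`g'(d f(σ)) f'(σ) = β⁻¹ ((d−1)/(2σ)) (1 − 1/N)`. -/
theorem stmt16 (N d : ℕ) (hN : 2 ≤ N) (hd : 2 ≤ d) (β : ℝ) (hβ : 0 < β)
    (g g' g'' f f' f'' : ℝ → ℝ)
    (hg : ∀ x, HasDerivAt g (g' x) x)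
    (hgd : ∀ x, HasDerivAt g' (g'' x) x)
    (hg'pos : ∀ x, 0 < g' x) (hg''nn : ∀ x, 0 ≤ g'' x)
    (hf : ∀ x, 0 < x → HasDerivAt f (f' x) x)
    (hfd : ∀ x, 0 < x → HasDerivAt f' (f'' x) x)
    (hf'nn : ∀ x, 0 < x → 0 ≤ f' x) (hf''pos : ∀ x, 0 < x → 0 < f'' x)
    (hL : Tendsto (fun s => g' ((d:ℝ) * f s) * f' s) atTop atTop) :
    ∃! s : ℝ, 0 < s ∧
      g' ((d:ℝ) * f s) * f' s = β⁻¹ * (((d:ℝ)-1)/(2*s)) * (1 - 1/(N:ℝ)) := by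
  have hd' : (2 : ℝ) ≤ d := by exact_mod_cast hd
  have hN' : (2 : ℝ) ≤ N := by exact_mod_cast hN
  have hgmono : Monotone g' := monotone_of_deriv_nonneg
    (fun x => (hgd x).differentiableAt) fun x => (hgd x).deriv.symm ▸ hg''nn x
  have hfcont : ContinuousOn f (Set.Ioi 0) := fun x hx =>
    (hf x hx).continuousAt.continuousWithinAt
  have hf'cont : ContinuousOn f' (Set.Ioi 0) := fun x hx =>
    (hfd x hx).continuousAt.continuousWithinAt
  have hgcont : Continuous g' := continuous_iff_continuousAt.2 fun x => (hgd x).continuousAt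
  have hfmono : MonotoneOn f (Set.Ioi 0) := by
    refine monotoneOn_of_deriv_nonneg (convex_Ioi 0) hfcont ?_ ?_ <;> rw [interior_Ioi]
    · exact fun x hx => (hf x hx).differentiableAt.differentiableWithinAt
    · exact fun x hx => (hf x hx).deriv.symm ▸ hf'nn x hx
  have hf'mono : StrictMonoOn f' (Set.Ioi 0) := by
    refine strictMonoOn_of_deriv_pos (convex_Ioi 0) hf'cont ?_
    rw [interior_Ioi]
    exact fun x hx => (hfd x hx).deriv.symm ▸ hf''pos x hx
  have hLmono : StrictMonoOn (fun s => g' ((d:ℝ) * f s) * f' s) (Set.Ioi 0) := by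
    intro a ha b hb hab
    have hle : g' ((d:ℝ) * f a) ≤ g' ((d:ℝ) * f b) :=
      hgmono (mul_le_mul_of_nonneg_left (hfmono ha hb hab.le) (by positivity))
    exact (mul_le_mul_of_nonneg_right hle (hf'nn a ha)).trans_lt
      (mul_lt_mul_of_pos_left (hf'mono ha hb hab) (hg'pos _))
  have hLcont : ContinuousOn (fun s => g' ((d:ℝ) * f s) * f' s) (Set.Ioi 0) :=
    (hgcont.comp_continuousOn (continuousOn_const.mul hfcont)).mul hf'cont
  have hC : 0 < β⁻¹ * (((d:ℝ) - 1) / 2) * (1 - 1 / (N:ℝ)) := by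
    have h1 : 0 < (d:ℝ) - 1 := by linarith
    have h2 : 0 < 1 - 1 / (N:ℝ) := by
      rw [sub_pos, div_lt_one (by linarith)]
      linarith
    positivity
  have hrhs : ∀ s : ℝ, β⁻¹ * (((d:ℝ)-1)/(2*s)) * (1 - 1/(N:ℝ))
      = β⁻¹ * (((d:ℝ) - 1) / 2) * (1 - 1 / (N:ℝ)) / s := fun s => by
    rw [← div_div]
    ring
  simp only [hrhs]
  exact existsUnique_eq_div_of_strictMonoOn hC hLmono hLcont
    (fun s hs => mul_nonneg (hg'pos _).le (hf'nn s hs)) hL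
end
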